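/- arXiv:2412.13887 — 9 statements merged into one kernel-verified Lean document; each statement's English description precedes it below -/
import Mathlib

section
/- Fix a set N of 4 agents and a set R of 2 rooms, with Leontief utilities over nonnegative valuations. For every α with 0 < α ≤ 1, there is no strategyproof mechanism that guarantees USW-α: for every mechanism M defined on all nonnegative valuation profiles on N and R, if M guarantees USW-α then there exist a profile (v, v̂), an agent i, and a unilateral misreport (v_i', v̂_i') such that agent i's true Leontief utility in M((v_i', v_{-i}), (v̂_i', v̂_{-i})) is strictly greater than its true Leontief utility in M(v, v̂). -/
open scoped BigOperators

/-- A roommate matching on agent set `N` and room set `R`: agents are paired up by a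
fixed-point-free involution `partner`, roommates share a room, and each room hosts
at most (hence, when `|N| = 2|R|`, exactly) one pair. -/
structure RMatching (N R : Type*) where
  partner : N → N
  room : N → R
  partner_ne : ∀ i, partner i ≠ i
  partner_invol : ∀ i, partner (partner i) = i
  room_partner : ∀ i, room (partner i) = room i
  room_pair : ∀ i j, room i = room j → j = i ∨ j = partner i

/-- Leontief utility of agent `i` in matching `μ`. -/
noncomputable def uLeontief {N R : Type*} (v : N → N → ℝ) (vh : N → R → ℝ)
    (μ : RMatching N R) (i : N) : ℝ :=
  min (v i (μ.partner i)) (vh i (μ.room i))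

/-- Utilitarian social welfare under Leontief utilities. -/
noncomputable def USWL {N R : Type*} [Fintype N] (v : N → N → ℝ) (vh : N → R → ℝ)
    (μ : RMatching N R) : ℝ :=
  ∑ i, uLeontief v vh μ i

/-- Agent `0` values only agent `1`, at `K`, and agent `1` values only agent `2`, at `L`. -/
noncomputable def conflictV (K L : ℝ) : Fin 4 → Fin 4 → ℝ :=
  ![![0, K, 0, 0], ![0, 0, L, 0], 0, 0]

/-- Agent `0` values both rooms at `K`, and agent `1` values both rooms at `L`. -/
noncomputable def conflictVh (K L : ℝ) : Fin 4 → Fin 2 → ℝ :=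
  ![fun _ => K, fun _ => L, 0, 0]

lemma conflictV_nonneg {K L : ℝ} (hK : 0 ≤ K) (hL : 0 ≤ L) (i j : Fin 4) :
    0 ≤ conflictV K L i j := by
  fin_cases i <;> fin_cases j <;> simp [conflictV, hK, hL]

lemma conflictVh_nonneg {K L : ℝ} (hK : 0 ≤ K) (hL : 0 ≤ L) (i : Fin 4) (r : Fin 2) :
    0 ≤ conflictVh K L i r := by
  fin_cases i <;> simp [conflictVh, hK, hL]

lemma update_conflictV_zero (K L K' : ℝ) :
    Function.update (conflictV K L) 0 (conflictV K' L 0) = conflictV K' L := by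
  funext i; fin_cases i <;> simp [conflictV]

lemma update_conflictVh_zero (K L K' : ℝ) :
    Function.update (conflictVh K L) 0 (conflictVh K' L 0) = conflictVh K' L := by
  funext i; fin_cases i <;> simp [conflictVh]

lemma update_conflictV_one (K L L' : ℝ) :
    Function.update (conflictV K L) 1 (conflictV K L' 1) = conflictV K L' := by
  funext i; fin_cases i <;> simp [conflictV]

lemma update_conflictVh_one (K L L' : ℝ) :
    Function.update (conflictVh K L) 1 (conflictVh K L' 1) = conflictVh K L' := by
  funext i; fin_cases i <;> simp [conflictVh]

lemma uLeontief_conflict_zero {K : ℝ} (hK : 0 ≤ K) (L : ℝ) (μ : RMatching (Fin 4) (Fin 2)) :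
    uLeontief (conflictV K L) (conflictVh K L) μ 0 = if μ.partner 0 = 1 then K else 0 := by
  unfold uLeontief
  generalize μ.partner 0 = p
  fin_cases p <;> simp [conflictV, conflictVh, hK]

lemma uLeontief_conflict_one (K : ℝ) {L : ℝ} (hL : 0 ≤ L) (μ : RMatching (Fin 4) (Fin 2)) :
    uLeontief (conflictV K L) (conflictVh K L) μ 1 = if μ.partner 1 = 2 then L else 0 := by
  unfold uLeontief
  generalize μ.partner 1 = p
  fin_cases p <;> simp [conflictV, conflictVh, hL]

lemma USWL_conflict {K L : ℝ} (hK : 0 ≤ K) (hL : 0 ≤ L) (μ : RMatching (Fin 4) (Fin 2)) :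
    USWL (conflictV K L) (conflictVh K L) μ =
      (if μ.partner 0 = 1 then K else 0) + (if μ.partner 1 = 2 then L else 0) := by
  have h2 : uLeontief (conflictV K L) (conflictVh K L) μ 2 = 0 := by
    simp [uLeontief, conflictV, conflictVh]
  have h3 : uLeontief (conflictV K L) (conflictVh K L) μ 3 = 0 := by
    simp [uLeontief, conflictV, conflictVh]
  rw [USWL, Fin.sum_univ_four, uLeontief_conflict_zero hK, uLeontief_conflict_one K hL, h2, h3]
  ring

/-- The matching with pairs `{0, 1}` and `{2, 3}`. -/
def matching01 : RMatching (Fin 4) (Fin 2) where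
  partner := ![1, 0, 3, 2]
  room := ![0, 0, 1, 1]
  partner_ne := by decide
  partner_invol := by decide
  room_partner := by decide
  room_pair := by decide

/-- The matching with pairs `{0, 3}` and `{1, 2}`. -/
def matching12 : RMatching (Fin 4) (Fin 2) where
  partner := ![3, 2, 1, 0]
  room := ![0, 1, 1, 0]
  partner_ne := by decide
  partner_invol := by decide
  room_partner := by decide
  room_pair := by decide

/-- No mechanism on 4 agents and 2 rooms that guarantees an `α`-fraction of the optimal
social welfare (for any `0 < α ≤ 1`) on all nonnegative valuation profiles can be
strategyproof, under Leontief utilities. -/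
theorem no_alpha_approx_SP_leontief (α : ℝ) (hα0 : 0 < α) (hα1 : α ≤ 1)
    (M : (Fin 4 → Fin 4 → ℝ) → (Fin 4 → Fin 2 → ℝ) → RMatching (Fin 4) (Fin 2))
    (husw : ∀ (v : Fin 4 → Fin 4 → ℝ) (vh : Fin 4 → Fin 2 → ℝ),
      (∀ i j, 0 ≤ v i j) → (∀ i r, 0 ≤ vh i r) →
      ∀ μ : RMatching (Fin 4) (Fin 2), α * USWL v vh μ ≤ USWL v vh (M v vh)) :
    ∃ (v : Fin 4 → Fin 4 → ℝ) (vh : Fin 4 → Fin 2 → ℝ),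
      (∀ i j, 0 ≤ v i j) ∧ (∀ i r, 0 ≤ vh i r) ∧
      ∃ (i : Fin 4) (vi' : Fin 4 → ℝ) (vhi' : Fin 2 → ℝ),
        (∀ j, 0 ≤ vi' j) ∧ (∀ r, 0 ≤ vhi' r) ∧
        uLeontief v vh (M v vh) i <
          uLeontief v vh (M (Function.update v i vi') (Function.update vh i vhi')) i := by
  have hK : (0 : ℝ) ≤ 2 / α := by positivity
  have hαK : α * (2 / α) = 2 := mul_div_cancel₀ 2 hα0.ne'
  have h01 : (M (conflictV (2 / α) 1) (conflictVh (2 / α) 1)).partner 0 = 1 := by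
    have h := husw _ _ (conflictV_nonneg hK zero_le_one) (conflictVh_nonneg hK zero_le_one)
      matching01
    rw [USWL_conflict hK zero_le_one, USWL_conflict hK zero_le_one] at h
    by_contra hne
    rw [if_neg hne, if_pos (show matching01.partner 0 = 1 from rfl),
      if_neg (show matching01.partner 1 ≠ 2 by decide)] at h
    split_ifs at h <;> norm_num [hαK] at h
  have h12 : (M (conflictV 1 (2 / α)) (conflictVh 1 (2 / α))).partner 1 = 2 := by
    have h := husw _ _ (conflictV_nonneg zero_le_one hK) (conflictVh_nonneg zero_le_one hK)
      matching12
    rw [USWL_conflict zero_le_one hK, USWL_conflict zero_le_one hK] at h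
    by_contra hne
    rw [if_neg hne, if_neg (show matching12.partner 0 ≠ 1 by decide),
      if_pos (show matching12.partner 1 = 2 from rfl)] at h
    split_ifs at h <;> norm_num [hαK] at h
  have hv := conflictV_nonneg zero_le_one zero_le_one
  have hvh := conflictVh_nonneg zero_le_one zero_le_one
  refine ⟨conflictV 1 1, conflictVh 1 1, hv, hvh, ?_⟩
  by_cases hp : (M (conflictV 1 1) (conflictVh 1 1)).partner 0 = 1
  · refine ⟨1, conflictV 1 (2 / α) 1, conflictVh 1 (2 / α) 1,
      conflictV_nonneg zero_le_one hK 1, conflictVh_nonneg zero_le_one hK 1, ?_⟩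
    have hp' : (M (conflictV 1 1) (conflictVh 1 1)).partner 1 = 0 := by
      rw [← hp, RMatching.partner_invol]
    rw [update_conflictV_one, update_conflictVh_one, uLeontief_conflict_one 1 zero_le_one,
      uLeontief_conflict_one 1 zero_le_one, if_pos h12, hp',
      if_neg (by decide)]
    positivity
  · refine ⟨0, conflictV (2 / α) 1 0, conflictVh (2 / α) 1 0,
      conflictV_nonneg hK zero_le_one 0, conflictVh_nonneg hK zero_le_one 0, ?_⟩
    rw [update_conflictV_zero, update_conflictVh_zero, uLeontief_conflict_zero zero_le_one,
      uLeontief_conflict_zero zero_le_one, if_pos h01, if_neg hp]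
    positivity
end

section
/- Fix a set N of 4 agents and a set R of 2 rooms, with additive utilities over nonnegative valuations. For every α with 0 < α ≤ 1, there is no strategyproof mechanism that guarantees USW-α: for every mechanism M defined on all nonnegative valuation profiles on N and R, if M guarantees USW-α then there exist a profile (v, v̂), an agent i, and a unilateral misreport (v_i', v̂_i') such that agent i's true additive utility in M((v_i', v_{-i}), (v̂_i', v̂_{-i})) is strictly greater than its true additive utility in M(v, v̂). -/
open scoped BigOperators

/-- Additive utility of agent `i` in matching `μ`. -/
noncomputable def uAdditive {N R : Type*} (v : N → N → ℝ) (vh : N → R → ℝ)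
    (μ : RMatching N R) (i : N) : ℝ :=
  v i (μ.partner i) + vh i (μ.room i)

/-- Utilitarian social welfare under additive utilities. -/
noncomputable def USWA {N R : Type*} [Fintype N] (v : N → N → ℝ) (vh : N → R → ℝ)
    (μ : RMatching N R) : ℝ :=
  ∑ i, uAdditive v vh μ i


/-- The valuations in which agent `0` values agent `1` at `a`, agent `1` values agent `2` at `b`,
and all other values are zero. -/
def chainVal (a b : ℝ) (i j : Fin 4) : ℝ :=
  if i = 0 ∧ j = 1 then a else if i = 1 ∧ j = 2 then b else 0

lemma chainVal_nonneg {a b : ℝ} (ha : 0 ≤ a) (hb : 0 ≤ b) (i j : Fin 4) :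
    0 ≤ chainVal a b i j := by
  unfold chainVal
  split_ifs <;> first | assumption | exact le_rfl

lemma update_chainVal_zero (a a' b : ℝ) :
    Function.update (chainVal a b) 0 (chainVal a' b 0) = chainVal a' b := by
  ext i j
  by_cases hi : i = 0 <;> simp [hi, chainVal]

lemma update_chainVal_one (a b b' : ℝ) :
    Function.update (chainVal a b) 1 (chainVal a b' 1) = chainVal a b' := by
  ext i j
  by_cases hi : i = 1 <;> simp [hi, chainVal]

lemma uAdditive_chainVal_zero (a b : ℝ) (μ : RMatching (Fin 4) (Fin 2)) :
    uAdditive (chainVal a b) 0 μ 0 = if μ.partner 0 = 1 then a else 0 := by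
  simp [uAdditive, chainVal]

lemma uAdditive_chainVal_one (a b : ℝ) (μ : RMatching (Fin 4) (Fin 2)) :
    uAdditive (chainVal a b) 0 μ 1 = if μ.partner 1 = 2 then b else 0 := by
  simp [uAdditive, chainVal]

lemma USWA_chainVal (a b : ℝ) (μ : RMatching (Fin 4) (Fin 2)) :
    USWA (chainVal a b) 0 μ =
      (if μ.partner 0 = 1 then a else 0) + (if μ.partner 1 = 2 then b else 0) := by
  simp [USWA, Fin.sum_univ_four, uAdditive, chainVal]

/-- The matching `{0, 1}, {2, 3}`. -/
def matchingZeroOne : RMatching (Fin 4) (Fin 2) where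
  partner := ![1, 0, 3, 2]
  room := ![0, 0, 1, 1]
  partner_ne := by decide
  partner_invol := by decide
  room_partner := by decide
  room_pair := by decide

/-- The matching `{0, 3}, {1, 2}`. -/
def matchingOneTwo : RMatching (Fin 4) (Fin 2) where
  partner := ![3, 2, 1, 0]
  room := ![0, 1, 1, 0]
  partner_ne := by decide
  partner_invol := by decide
  room_partner := by decide
  room_pair := by decide

/-- No mechanism on 4 agents and 2 rooms that guarantees an `α`-fraction of the optimal
social welfare (for any `0 < α ≤ 1`) on all nonnegative valuation profiles can be
strategyproof, under additive utilities. -/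
theorem no_alpha_approx_SP_additive (α : ℝ) (hα0 : 0 < α) (hα1 : α ≤ 1)
    (M : (Fin 4 → Fin 4 → ℝ) → (Fin 4 → Fin 2 → ℝ) → RMatching (Fin 4) (Fin 2))
    (husw : ∀ (v : Fin 4 → Fin 4 → ℝ) (vh : Fin 4 → Fin 2 → ℝ),
      (∀ i j, 0 ≤ v i j) → (∀ i r, 0 ≤ vh i r) →
      ∀ μ : RMatching (Fin 4) (Fin 2), α * USWA v vh μ ≤ USWA v vh (M v vh)) :
    ∃ (v : Fin 4 → Fin 4 → ℝ) (vh : Fin 4 → Fin 2 → ℝ),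
      (∀ i j, 0 ≤ v i j) ∧ (∀ i r, 0 ≤ vh i r) ∧
      ∃ (i : Fin 4) (vi' : Fin 4 → ℝ) (vhi' : Fin 2 → ℝ),
        (∀ j, 0 ≤ vi' j) ∧ (∀ r, 0 ≤ vhi' r) ∧
        uAdditive v vh (M v vh) i <
          uAdditive v vh (M (Function.update v i vi') (Function.update vh i vhi')) i := by
  have hK : (0 : ℝ) ≤ 2 / α := by positivity
  have hαK : α * (2 / α) = 2 := by field_simp
  refine ⟨chainVal 1 1, 0, chainVal_nonneg zero_le_one zero_le_one, fun _ _ => le_rfl, ?_⟩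
  by_cases h : (M (chainVal 1 1) 0).partner 0 = 1
  · have h' : (M (chainVal 1 1) 0).partner 1 ≠ 2 := by
      have := (M (chainVal 1 1) 0).partner_invol 0
      rw [h] at this
      simp [this]
    refine ⟨1, chainVal 1 (2 / α) 1, 0, chainVal_nonneg zero_le_one hK 1, fun _ => le_rfl, ?_⟩
    have hw := husw (chainVal 1 (2 / α)) 0 (chainVal_nonneg zero_le_one hK)
      (fun _ _ => le_rfl) matchingOneTwo
    have hpair : (M (chainVal 1 (2 / α)) 0).partner 1 = 2 := by
      by_contra hne
      simp only [USWA_chainVal, matchingOneTwo, hne] at hw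
      split_ifs at hw <;> simp_all <;> linarith
    rw [update_chainVal_one, show Function.update (0 : Fin 4 → Fin 2 → ℝ) 1 0 = 0 from
      Function.update_eq_self 1 _, uAdditive_chainVal_one, uAdditive_chainVal_one]
    simp [hpair, h']
  · refine ⟨0, chainVal (2 / α) 1 0, 0, chainVal_nonneg hK zero_le_one 0, fun _ => le_rfl, ?_⟩
    have hw := husw (chainVal (2 / α) 1) 0 (chainVal_nonneg hK zero_le_one)
      (fun _ _ => le_rfl) matchingZeroOne
    have hpair : (M (chainVal (2 / α) 1) 0).partner 0 = 1 := by
      by_contra hne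
      simp only [USWA_chainVal, matchingZeroOne, hne] at hw
      split_ifs at hw <;> simp_all <;> linarith
    rw [update_chainVal_zero, show Function.update (0 : Fin 4 → Fin 2 → ℝ) 0 0 = 0 from
      Function.update_eq_self 0 _, uAdditive_chainVal_zero, uAdditive_chainVal_zero]
    simp [hpair, h]
end

section
/- Fix a set N of 4 agents and a set R of 2 rooms, with additive utilities and binary valuations whose compatibility valuations are symmetric. For every α with 3/4 < α ≤ 1, there is no strategyproof mechanism that guarantees USW-α: for every mechanism M defined on all binary valuation profiles with symmetric compatibility valuations on N and R, if M guarantees USW-α then there exist such a profile (v, v̂), an agent i, and a binary unilateral misreport changing only agent i's room valuation v̂_i (so the misreported profile is still binary with symmetric compatibility valuations) such that agent i's true additive utility strictly increases under the misreport. -/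
open scoped BigOperators

/-- Binary (0/1) valuations. -/
def Binary {N R : Type*} (v : N → N → ℝ) (vh : N → R → ℝ) : Prop :=
  (∀ i j, v i j = 0 ∨ v i j = 1) ∧ (∀ i r, vh i r = 0 ∨ vh i r = 1)

/-- Symmetric compatibility valuations. -/
def Symm {N : Type*} (v : N → N → ℝ) : Prop :=
  ∀ i j, v i j = v j i

set_option maxRecDepth 20000 in
/-- A matching of four agents into two rooms is given by one of the three pairings and the room
of agent `0`. -/
theorem RMatching.four_two_cases (μ : RMatching (Fin 4) (Fin 2)) :
    (μ.partner = ![1, 0, 3, 2] ∨ μ.partner = ![2, 3, 0, 1] ∨ μ.partner = ![3, 2, 1, 0]) ∧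
      μ.room (μ.partner 0) = μ.room 0 ∧ ∀ j, j ≠ 0 → j ≠ μ.partner 0 →
        μ.room j = 1 - μ.room 0 := by
  refine ⟨?_, μ.room_partner 0, fun j h0 h1 => ?_⟩
  · have key : ∀ p : Fin 4 → Fin 4, (∀ i, p i ≠ i) → (∀ i, p (p i) = i) →
        p = ![1, 0, 3, 2] ∨ p = ![2, 3, 0, 1] ∨ p = ![3, 2, 1, 0] := by
      decide
    exact key μ.partner μ.partner_ne μ.partner_invol
  · have h : μ.room 0 ≠ μ.room j := fun h => (μ.room_pair 0 j h).elim h0 h1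
    generalize μ.room j = a at h ⊢
    generalize μ.room 0 = b at h ⊢
    revert a b
    decide

/-- The matching pairing agents `0, 1` in room `0` and agents `2, 3` in room `1`. -/
def matchZeroOne : RMatching (Fin 4) (Fin 2) where
  partner := ![1, 0, 3, 2]
  room := ![0, 0, 1, 1]
  partner_ne := by decide
  partner_invol := by decide
  room_partner := by decide
  room_pair := by decide

/-- The matching pairing agents `0, 2` in room `0` and agents `1, 3` in room `1`. -/
def matchZeroTwo : RMatching (Fin 4) (Fin 2) where
  partner := ![2, 3, 0, 1]
  room := ![0, 1, 0, 1]
  partner_ne := by decide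
  partner_invol := by decide
  room_partner := by decide
  room_pair := by decide

/-- Agent `0` is compatible with agents `1` and `2`; no other pair is compatible. -/
def pathCompat : Fin 4 → Fin 4 → ℝ :=
  ![![0, 1, 1, 0], ![1, 0, 0, 0], ![1, 0, 0, 0], ![0, 0, 0, 0]]

/-- Agent `3` values room `1`, agents `1` and `2` value room `0` at `b` and `c`. -/
def contestedRooms (b c : ℝ) : Fin 4 → Fin 2 → ℝ :=
  ![![0, 0], ![b, 0], ![c, 0], ![0, 1]]

theorem pathCompat_symm : Symm pathCompat := by
  intro i j
  fin_cases i <;> fin_cases j <;> rfl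

theorem binary_pathCompat_contestedRooms {b c : ℝ} (hb : b = 0 ∨ b = 1) (hc : c = 0 ∨ c = 1) :
    Binary pathCompat (contestedRooms b c) := by
  constructor
  · intro i j
    fin_cases i <;> fin_cases j <;> simp [pathCompat]
  · intro i r
    fin_cases i <;> fin_cases r <;> simp [contestedRooms, hb, hc]

theorem USWA_matchZeroOne (b c : ℝ) :
    USWA pathCompat (contestedRooms b c) matchZeroOne = 3 + b := by
  simp [USWA, uAdditive, Fin.sum_univ_four, pathCompat, contestedRooms, matchZeroOne]
  ring

theorem USWA_matchZeroTwo (b c : ℝ) :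
    USWA pathCompat (contestedRooms b c) matchZeroTwo = 3 + c := by
  simp [USWA, uAdditive, Fin.sum_univ_four, pathCompat, contestedRooms, matchZeroTwo]
  ring

/-- A matching of welfare above `3` puts agent `0` in room `0` with one of agents `1` and `2`
who values that room. -/
theorem partner_room_of_three_lt_USWA {b c : ℝ} (hb : b = 0 ∨ b = 1) (hc : c = 0 ∨ c = 1)
    {μ : RMatching (Fin 4) (Fin 2)} (h : 3 < USWA pathCompat (contestedRooms b c) μ) :
    (b = 1 ∧ μ.partner = ![1, 0, 3, 2] ∧ μ.room 1 = 0 ∧ μ.room 2 = 1) ∨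
      (c = 1 ∧ μ.partner = ![2, 3, 0, 1] ∧ μ.room 1 = 1 ∧ μ.room 2 = 0) := by
  obtain ⟨hp, hr, hr'⟩ := μ.four_two_cases
  rcases hp with hp | hp | hp <;>
  · have h1 := hr' 1
    have h2 := hr' 2
    have h3 := hr' 3
    obtain h0 | h0 : μ.room 0 = 0 ∨ μ.room 0 = 1 := by omega
    all_goals
      simp [hp, h0] at hr h1 h2 h3
      rcases hb with rfl | rfl <;> rcases hc with rfl | rfl <;>
        simp [USWA, uAdditive, Fin.sum_univ_four, pathCompat, contestedRooms, *] at h ⊢ <;>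
        norm_num at h

/-- Under binary valuations with symmetric compatibility valuations and additive utilities,
no mechanism on 4 agents and 2 rooms that guarantees an `α`-fraction of the optimal social
welfare for `α > 3/4` can be strategyproof: some agent can strictly gain by misreporting
only its (binary) room valuation (which preserves binaryness and symmetry). -/
theorem no_SP_beyond_three_fourths_binary_symmetric_additive
    (α : ℝ) (hα0 : 3 / 4 < α) (hα1 : α ≤ 1)
    (M : (Fin 4 → Fin 4 → ℝ) → (Fin 4 → Fin 2 → ℝ) → RMatching (Fin 4) (Fin 2))
    (husw : ∀ (v : Fin 4 → Fin 4 → ℝ) (vh : Fin 4 → Fin 2 → ℝ), Binary v vh → Symm v →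
      ∀ μ : RMatching (Fin 4) (Fin 2), α * USWA v vh μ ≤ USWA v vh (M v vh)) :
    ∃ (v : Fin 4 → Fin 4 → ℝ) (vh : Fin 4 → Fin 2 → ℝ),
      Binary v vh ∧ Symm v ∧
      ∃ (i : Fin 4) (vhi' : Fin 2 → ℝ),
        (∀ r, vhi' r = 0 ∨ vhi' r = 1) ∧
        uAdditive v vh (M v vh) i <
          uAdditive v vh (M v (Function.update vh i vhi')) i := by
  have welfare {b c : ℝ} (hb : b = 0 ∨ b = 1) (hc : c = 0 ∨ c = 1) (hbc : b = 1 ∨ c = 1) :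
      3 < USWA pathCompat (contestedRooms b c) (M pathCompat (contestedRooms b c)) := by
    have hM := husw _ _ (binary_pathCompat_contestedRooms hb hc) pathCompat_symm
    rcases hbc with rfl | rfl
    · have := hM matchZeroOne
      rw [USWA_matchZeroOne] at this
      linarith
    · have := hM matchZeroTwo
      rw [USWA_matchZeroTwo] at this
      linarith
  have outcome {b c : ℝ} (hb : b = 0 ∨ b = 1) (hc : c = 0 ∨ c = 1) (hbc : b = 1 ∨ c = 1) :=
    partner_room_of_three_lt_USWA hb hc (welfare hb hc hbc)
  have bin (r : Fin 2) : (![1, 0] : Fin 2 → ℝ) r = 0 ∨ (![1, 0] : Fin 2 → ℝ) r = 1 := by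
    fin_cases r <;> simp
  have update_one : Function.update (contestedRooms 0 1) 1 ![1, 0] = contestedRooms 1 1 := by
    ext i r
    fin_cases i <;> simp [contestedRooms, Function.update]
  have update_two : Function.update (contestedRooms 1 0) 2 ![1, 0] = contestedRooms 1 1 := by
    ext i r
    fin_cases i <;> simp [contestedRooms, Function.update]
  rcases outcome (b := 1) (c := 1) (.inr rfl) (.inr rfl) (.inl rfl) with
    ⟨-, hp, h1, -⟩ | ⟨-, hp, -, h2⟩
  · refine ⟨pathCompat, contestedRooms 0 1,
      binary_pathCompat_contestedRooms (.inl rfl) (.inr rfl), pathCompat_symm, 1, ![1, 0], bin, ?_⟩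
    rcases outcome (b := 0) (c := 1) (.inl rfl) (.inr rfl) (.inr rfl) with
      ⟨h, -⟩ | ⟨-, hp', h1', -⟩
    · norm_num at h
    · rw [update_one]
      rw [uAdditive, uAdditive, hp, h1, hp', h1']
      simp [pathCompat, contestedRooms]
  · refine ⟨pathCompat, contestedRooms 1 0,
      binary_pathCompat_contestedRooms (.inr rfl) (.inl rfl), pathCompat_symm, 2, ![1, 0], bin, ?_⟩
    rcases outcome (b := 1) (c := 0) (.inr rfl) (.inl rfl) (.inl rfl) with
      ⟨-, hp', -, h2'⟩ | ⟨h, -⟩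
    · rw [update_two]
      rw [uAdditive, uAdditive, hp, h2, hp', h2']
      simp [pathCompat, contestedRooms]
    · norm_num at h
end

section
/- Under binary valuations and Leontief utilities, the Welfare Set Reduction mechanism maximizes social welfare and is strategyproof. Precisely, for any ordering σ of the agents: (a) S_{2n} is nonempty and every matching in S_{2n} has maximum social welfare; and (b) for every agent i, every binary unilateral misreport (v_i', v̂_i') by i, every μ in the set S_{2n} computed from the true profile, and every μ' in the set S_{2n} computed from the misreported profile, agent i's true Leontief utility satisfies u_i(μ) ≥ u_i(μ'). -/
open scoped BigOperators

/-- Social welfare for an abstract profile `u` of per-agent utilities over matchings. -/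
noncomputable def USWu {N R : Type*} [Fintype N] (u : N → RMatching N R → ℝ)
    (μ : RMatching N R) : ℝ :=
  ∑ i, u i μ

/-- One step of the Welfare Set Reduction mechanism: restrict `S` to the matchings
maximizing agent `a`'s utility over `S`. -/
def wsrStep {N R : Type*} (u : N → RMatching N R → ℝ)
    (S : Set (RMatching N R)) (a : N) : Set (RMatching N R) :=
  {μ ∈ S | ∀ μ' ∈ S, u a μ' ≤ u a μ}

/-- The final set `S_{2n}` of the Welfare Set Reduction mechanism: start with all
maximum-welfare matchings and successively reduce along the agent ordering `L`. -/
noncomputable def WSR {N R : Type*} [Fintype N] (u : N → RMatching N R → ℝ)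
    (L : List N) : Set (RMatching N R) :=
  L.foldl (wsrStep u) {μ | ∀ μ', USWu u μ' ≤ USWu u μ}

theorem RMatching.finite (N R : Type*) [Finite N] [Finite R] : Finite (RMatching N R) := by
  refine Finite.of_injective
    (fun μ : RMatching N R => ((μ.partner, μ.room) : (N → N) × (N → R))) ?_
  rintro ⟨p, r, _, _, _, _⟩ ⟨p', r', _, _, _, _⟩ h
  simp only [Prod.mk.injEq] at h
  obtain ⟨rfl, rfl⟩ := h
  rfl

theorem RMatching.nonempty_of_card {N R : Type*} [Fintype N] [Fintype R]
    (h : Fintype.card N = 2 * Fintype.card R) : Nonempty (RMatching N R) := by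
  have e : N ≃ R × Bool := Fintype.equivOfCardEq (by simp [h, mul_comm])
  refine ⟨{
    partner := fun i => e.symm ((e i).1, !(e i).2)
    room := fun i => (e i).1
    partner_ne := fun i hi => ?_
    partner_invol := fun i => by simp
    room_partner := fun i => by simp
    room_pair := fun i j hij => ?_ }⟩
  · have h2 := congrArg (fun x => (e x).2) hi
    simp at h2
  · rw [Equiv.eq_symm_apply, ← e.injective.eq_iff, Prod.ext_iff, Prod.ext_iff]
    cases h1 : (e i).2 <;> cases h2 : (e j).2 <;> simp_all

theorem foldl_wsrStep_subset {N R : Type*} (u : N → RMatching N R → ℝ) (L : List N)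
    (S : Set (RMatching N R)) : L.foldl (wsrStep u) S ⊆ S := by
  induction L generalizing S with
  | nil => exact subset_rfl
  | cons a L ih => exact (ih (wsrStep u S a)).trans fun _ hμ => hμ.1

theorem foldl_wsrStep_nonempty {N R : Type*} [Finite (RMatching N R)]
    (u : N → RMatching N R → ℝ) (L : List N) (S : Set (RMatching N R)) (hS : S.Nonempty) :
    (L.foldl (wsrStep u) S).Nonempty := by
  induction L generalizing S with
  | nil => exact hS
  | cons a L ih =>
    obtain ⟨μ, hμ, hmax⟩ := Set.exists_max_image S (u a) S.toFinite hS
    exact ih _ ⟨μ, hμ, hmax⟩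

/-- If two utility profiles agree at `μ` and `μ'`, and reduction under one profile selects `μ`
while reduction under the other selects `μ'`, then every processed agent is indifferent between
`μ` and `μ'`. -/
theorem utility_eq_of_mem_foldl_wsrStep {N R : Type*} {u u' : N → RMatching N R → ℝ}
    {μ μ' : RMatching N R} (hμ : ∀ a, u' a μ = u a μ) (hμ' : ∀ a, u' a μ' = u a μ')
    (L : List N) (S S' : Set (RMatching N R)) (hS : μ' ∈ S) (hS' : μ ∈ S')
    (h : μ ∈ L.foldl (wsrStep u) S) (h' : μ' ∈ L.foldl (wsrStep u') S') :
    ∀ a ∈ L, u a μ = u a μ' := by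
  induction L generalizing S S' with
  | nil => simp
  | cons a L ih =>
    rw [List.foldl_cons] at h h'
    have m := foldl_wsrStep_subset u L _ h
    have m' := foldl_wsrStep_subset u' L _ h'
    have le : u a μ' ≤ u a μ := m.2 _ hS
    have ge : u a μ ≤ u a μ' := by simpa only [hμ, hμ'] using m'.2 _ hS'
    have heq := le_antisymm ge le
    have step : μ' ∈ wsrStep u S a := ⟨hS, fun ν hν => (m.2 ν hν).trans ge⟩
    have step' : μ ∈ wsrStep u' S' a :=
      ⟨hS', fun ν hν => (m'.2 ν hν).trans (by rw [hμ, hμ']; exact le)⟩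
    exact List.forall_mem_cons.2 ⟨heq, ih _ _ step step' h h'⟩

/-- Strategyproofness of welfare set reduction for arbitrary binary utilities of agent `i`. -/
theorem WSR_utility_le {N R : Type*} [Fintype N] {u u' : N → RMatching N R → ℝ} {i : N}
    (hu : ∀ μ, u i μ = 0 ∨ u i μ = 1) (hu' : ∀ μ, u' i μ = 0 ∨ u' i μ = 1)
    (hne : ∀ a, a ≠ i → u' a = u a) {L : List N} (hi : i ∈ L) {μ μ' : RMatching N R}
    (h : μ ∈ WSR u L) (h' : μ' ∈ WSR u' L) : u i μ' ≤ u i μ := by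
  classical
  by_contra! hlt
  have h0 : u i μ = 0 := by
    rcases hu μ with hμ | hμ <;> rcases hu μ' with hμ' | hμ' <;> linarith
  have h1 : u i μ' = 1 := by
    rcases hu μ' with hμ' | hμ' <;> linarith
  have opt : ∀ ν, USWu u ν ≤ USWu u μ := foldl_wsrStep_subset u L _ h
  have opt' : ∀ ν, USWu u' ν ≤ USWu u' μ' := foldl_wsrStep_subset u' L _ h'
  have split : ∀ ν, USWu u' ν - u' i ν = USWu u ν - u i ν := fun ν => by
    simp only [USWu, ← Finset.add_sum_erase _ _ (Finset.mem_univ i), add_sub_cancel_left]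
    exact Finset.sum_congr rfl fun a ha => by rw [hne a (Finset.ne_of_mem_erase ha)]
  have d := opt μ'
  have d' := opt' μ
  have s := split μ
  have s' := split μ'
  have agree : u' i μ = 0 ∧ u' i μ' = 1 := by
    rcases hu' μ with hμ | hμ <;> rcases hu' μ' with hμ' | hμ' <;>
      first | exact ⟨hμ, hμ'⟩ | (exfalso; linarith)
  have hμ : ∀ a, u' a μ = u a μ := fun a => by
    by_cases ha : a = i
    · rw [ha, agree.1, h0]
    · rw [hne a ha]
  have hμ' : ∀ a, u' a μ' = u a μ' := fun a => by
    by_cases ha : a = i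
    · rw [ha, agree.2, h1]
    · rw [hne a ha]
  have hS : μ' ∈ {μ | ∀ ν, USWu u ν ≤ USWu u μ} := fun ν => by linarith [opt ν, agree.1, agree.2]
  have hS' : μ ∈ {μ | ∀ ν, USWu u' ν ≤ USWu u' μ} := fun ν => by linarith [opt' ν, agree.1, agree.2]
  exact hlt.ne (utility_eq_of_mem_foldl_wsrStep hμ hμ' L _ _ hS hS' h h' i hi)

theorem uLeontief_eq_zero_or_one {N R : Type*} {v : N → N → ℝ} {vh : N → R → ℝ} {i : N}
    (hv : ∀ j, v i j = 0 ∨ v i j = 1) (hvh : ∀ r, vh i r = 0 ∨ vh i r = 1)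
    (μ : RMatching N R) : uLeontief v vh μ i = 0 ∨ uLeontief v vh μ i = 1 := by
  unfold uLeontief
  rcases hv (μ.partner i) with h | h <;> rcases hvh (μ.room i) with h' | h' <;> simp [h, h']

/-- Under binary Leontief utilities, the Welfare Set Reduction mechanism (along any agent
ordering `L`) has a nonempty final set, every matching in it maximizes social welfare, and
it is strategyproof: no binary unilateral misreport can strictly increase an agent's true
Leontief utility, whichever matchings are selected from the final sets. -/
theorem welfare_set_reduction_maxUSW_and_SP
    {N R : Type*} [Fintype N] [Fintype R] [DecidableEq N] (n : ℕ)
    (hN : Fintype.card N = 2 * n) (hR : Fintype.card R = n)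
    (v : N → N → ℝ) (vh : N → R → ℝ) (hbin : Binary v vh)
    (L : List N) (hnd : L.Nodup) (hfull : ∀ a : N, a ∈ L) :
    (WSR (fun a μ => uLeontief v vh μ a) L).Nonempty ∧
    (∀ μ ∈ WSR (fun a μ => uLeontief v vh μ a) L,
      ∀ μ' : RMatching N R,
        USWu (fun a μ'' => uLeontief v vh μ'' a) μ' ≤ USWu (fun a μ'' => uLeontief v vh μ'' a) μ) ∧
    (∀ (i : N) (vi' : N → ℝ) (vhi' : R → ℝ),
      (∀ j, vi' j = 0 ∨ vi' j = 1) → (∀ r, vhi' r = 0 ∨ vhi' r = 1) →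
      ∀ μ ∈ WSR (fun a μ'' => uLeontief v vh μ'' a) L,
      ∀ μ' ∈ WSR (fun a μ'' =>
          uLeontief (Function.update v i vi') (Function.update vh i vhi') μ'' a) L,
        uLeontief v vh μ' i ≤ uLeontief v vh μ i) := by
  have := RMatching.finite N R
  have := RMatching.nonempty_of_card (N := N) (R := R) (by rw [hN, hR])
  refine ⟨foldl_wsrStep_nonempty _ L _ (Finite.exists_max _),
    fun μ hμ => foldl_wsrStep_subset _ L _ hμ, ?_⟩
  intro i vi' vhi' hv' hvh' μ hμ μ' hμ'
  refine WSR_utility_le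
    (uLeontief_eq_zero_or_one (hbin.1 i) (hbin.2 i))
    (uLeontief_eq_zero_or_one (by simpa using hv') (by simpa using hvh'))
    (fun a ha => ?_) (hfull i) hμ hμ'
  funext ν
  simp [uLeontief, Function.update_of_ne ha]
end

section
/- The 1/6 bound for L/T-maximal matchings is tight: there exists a roommate matching instance with 6 agents and 3 rooms and binary valuations such that, under Leontief utilities, the maximum social welfare over all roommate matchings equals 6, yet there exists an L/T-maximal matching of welfare exactly 1. -/
open scoped BigOperators

/-- A triple `(i, j, r)` is a triangle (T): the two (distinct) agents like each other and
both like the room. -/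
def IsT {N R : Type*} (v : N → N → ℝ) (vh : N → R → ℝ) (t : N × N × R) : Prop :=
  t.1 ≠ t.2.1 ∧ v t.1 t.2.1 = 1 ∧ v t.2.1 t.1 = 1 ∧ vh t.1 t.2.2 = 1 ∧ vh t.2.1 t.2.2 = 1

/-- A triple `(i, j, r)` is L-shaped (L): the two (distinct) agents like each other and
exactly one of them likes the room. -/
def IsL {N R : Type*} (v : N → N → ℝ) (vh : N → R → ℝ) (t : N × N × R) : Prop :=
  t.1 ≠ t.2.1 ∧ v t.1 t.2.1 = 1 ∧ v t.2.1 t.1 = 1 ∧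
    ((vh t.1 t.2.2 = 1 ∧ vh t.2.1 t.2.2 = 0) ∨ (vh t.1 t.2.2 = 0 ∧ vh t.2.1 t.2.2 = 1))

/-- Two triples are disjoint: they share no agent and no room. -/
def TripleDisj {N R : Type*} (t t' : N × N × R) : Prop :=
  t.1 ≠ t'.1 ∧ t.1 ≠ t'.2.1 ∧ t.2.1 ≠ t'.1 ∧ t.2.1 ≠ t'.2.1 ∧ t.2.2 ≠ t'.2.2

/-- An L/T-matching: a set of pairwise disjoint triples, each an L or a T. -/
def LTMatching {N R : Type*} (v : N → N → ℝ) (vh : N → R → ℝ)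
    (M : Finset (N × N × R)) : Prop :=
  (∀ t ∈ M, IsL v vh t ∨ IsT v vh t) ∧
  (∀ t ∈ M, ∀ t' ∈ M, t ≠ t' → TripleDisj t t')

/-- Agent `a` is covered by the triple set `M`. -/
def CoveredAgent {N R : Type*} (M : Finset (N × N × R)) (a : N) : Prop :=
  ∃ t ∈ M, t.1 = a ∨ t.2.1 = a

/-- Room `r` is covered by the triple set `M`. -/
def CoveredRoom {N R : Type*} (M : Finset (N × N × R)) (r : R) : Prop :=
  ∃ t ∈ M, t.2.2 = r

/-- An L/T-matching is maximal if no triple of two unmatched agents and an unmatched room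
is an L or a T. -/
def LTMaximal {N R : Type*} (v : N → N → ℝ) (vh : N → R → ℝ)
    (M : Finset (N × N × R)) : Prop :=
  LTMatching v vh M ∧
  ∀ (i j : N) (r : R), ¬ CoveredAgent M i → ¬ CoveredAgent M j → ¬ CoveredRoom M r →
    ¬ (IsL v vh (i, j, r) ∨ IsT v vh (i, j, r))

/-- The welfare of an L/T-matching: the number of agents in its triples receiving
Leontief utility 1 (2 for a T, 1 for an L). -/
noncomputable def ltWelfare {N R : Type*} (v : N → N → ℝ) (vh : N → R → ℝ)
    (M : Finset (N × N × R)) : ℝ :=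
  ∑ t ∈ M, (min (v t.1 t.2.1) (vh t.1 t.2.2) + min (v t.2.1 t.1) (vh t.2.1 t.2.2))


/-- The matching pairing agents `2k` and `2k + 1` in room `k`. -/
def consecutiveMatching : RMatching (Fin 6) (Fin 3) where
  partner := ![1, 0, 3, 2, 5, 4]
  room := ![0, 0, 1, 1, 2, 2]
  partner_ne := by decide
  partner_invol := by decide
  room_partner := by decide
  room_pair := by decide

/-- Mutually compatible pairs: the pairs of `consecutiveMatching`, together with `{0, 2}`. -/
def Compatible (i j : Fin 6) : Prop :=
  j = consecutiveMatching.partner i ∨ (i = 0 ∧ j = 2) ∨ (i = 2 ∧ j = 0)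

/-- Every agent accepts its room in `consecutiveMatching`; agent `0` also accepts room `2`. -/
def AcceptsRoom (i : Fin 6) (r : Fin 3) : Prop :=
  r = consecutiveMatching.room i ∨ (i = 0 ∧ r = 2)

instance : DecidableRel Compatible := fun i j => by unfold Compatible; infer_instance

instance : DecidableRel AcceptsRoom := fun i r => by unfold AcceptsRoom; infer_instance

theorem USWL_le_card {N R : Type*} [Fintype N] {v : N → N → ℝ} {vh : N → R → ℝ}
    (h : Binary v vh) (μ : RMatching N R) : USWL v vh μ ≤ Fintype.card N := by
  have hle (i : N) : uLeontief v vh μ i ≤ 1 :=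
    (min_le_left _ _).trans (by rcases h.1 i (μ.partner i) with h | h <;> simp [h])
  simpa [USWL] using Finset.sum_le_sum fun i (_ : i ∈ Finset.univ) => hle i

theorem binary_ite {N R : Type*} (p : N → N → Prop) (q : N → R → Prop)
    [DecidableRel p] [DecidableRel q] :
    Binary (fun i j => if p i j then 1 else 0) (fun i r => if q i r then 1 else 0) :=
  ⟨fun i j => (ite_eq_or_eq (p i j) 1 0).symm, fun i r => (ite_eq_or_eq (q i r) 1 0).symm⟩

/-- The 1/6 bound for L/T-maximal matchings is tight: there is a binary instance with 6
agents and 3 rooms whose maximum Leontief social welfare is 6, yet which admits an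
L/T-maximal matching of welfare exactly 1. -/
theorem LT_maximal_one_sixth_tight :
    ∃ (v : Fin 6 → Fin 6 → ℝ) (vh : Fin 6 → Fin 3 → ℝ),
      Binary v vh ∧
      (∃ μ : RMatching (Fin 6) (Fin 3), USWL v vh μ = 6) ∧
      (∀ μ : RMatching (Fin 6) (Fin 3), USWL v vh μ ≤ 6) ∧
      ∃ M : Finset (Fin 6 × Fin 6 × Fin 3), LTMaximal v vh M ∧ ltWelfare v vh M = 1 := by
  have hL : Compatible 0 2 ∧ Compatible 2 0 ∧ AcceptsRoom 0 2 ∧ ¬ AcceptsRoom 2 2 := by decide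
  have hbin := binary_ite Compatible AcceptsRoom
  refine ⟨_, _, hbin, ⟨consecutiveMatching, ?_⟩,
    fun μ => by simpa using USWL_le_card hbin μ, {(0, 2, 2)}, ⟨⟨?_, ?_⟩, ?_⟩, ?_⟩
  · have hc (i : Fin 6) : Compatible i (consecutiveMatching.partner i) := .inl rfl
    have hr (i : Fin 6) : AcceptsRoom i (consecutiveMatching.room i) := .inl rfl
    simp [USWL, uLeontief, hc, hr]
  · simp [IsL, hL]
  · simp
  · have h : ∀ (i j : Fin 6) (r : Fin 3), i ≠ 0 → i ≠ 2 → j ≠ 0 → j ≠ 2 → r ≠ 2 →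
        Compatible i j → (AcceptsRoom i r ∨ AcceptsRoom j r) → False := by decide
    intro i j r hi hj hr
    simp only [CoveredAgent, CoveredRoom, Finset.mem_singleton, exists_eq_left, not_or] at hi hj hr
    have := h i j r (Ne.symm hi.1) (Ne.symm hi.2) (Ne.symm hj.1) (Ne.symm hj.2) (Ne.symm hr)
    simp only [IsL, IsT, ite_eq_left_iff, zero_ne_one, imp_false, not_not]
    tauto
  · simp [ltWelfare, hL]
end

section
/- Let each agent i have an arbitrary nonnegative utility value u_i(j, r) ≥ 0 for every roommate j ∈ N\{i} and room r ∈ R (this covers Leontief, additive, or any other utility model). Every matching produced by the Triangle-then-L (greedy) procedure achieves at least one third of the maximum social welfare: if μ = {t_1, …, t_n} is such that each t_k = (i, j, r) maximizes u_i(j, r) + u_j(i, r) among all triples disjoint from t_1, …, t_{k-1}, then USW(μ) ≥ (1/3) · max_{μ'} USW(μ'). -/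
open scoped BigOperators

/-- Social welfare of a matching for abstract per-agent utilities `u i j r` over
(roommate, room) pairs. -/
noncomputable def USWGen {N R : Type*} [Fintype N] (u : N → N → R → ℝ)
    (μ : RMatching N R) : ℝ :=
  ∑ i, u i (μ.partner i) (μ.room i)

/-- Combined utility of the two agents of a triple. -/
noncomputable def tripleWeight {N R : Type*} (u : N → N → R → ℝ) (t : N × N × R) : ℝ :=
  u t.1 t.2.1 t.2.2 + u t.2.1 t.1 t.2.2

namespace RMatching

variable {N R : Type*} [Fintype N]

/-- The triple to which a roommate matching assigns an agent. -/
def triple (μ : RMatching N R) (i : N) : N × N × R :=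
  (i, μ.partner i, μ.room i)

theorem sum_tripleWeight_triple (μ : RMatching N R) (u : N → N → R → ℝ) :
    ∑ i, tripleWeight u (μ.triple i) = 2 * USWGen u μ := by
  have h : ∑ i, u (μ.partner i) i (μ.room i) = ∑ i, u i (μ.partner i) (μ.room i) :=
    Fintype.sum_bijective μ.partner (Function.Involutive.bijective μ.partner_invol) _ _
      fun i => by rw [μ.partner_invol, μ.room_partner]
  simp only [tripleWeight, triple, USWGen, Finset.sum_add_distrib, h]
  ring

open Classical in
theorem card_filter_room_le_two (μ : RMatching N R) (r : R) :
    (Finset.univ.filter fun i => μ.room i = r).card ≤ 2 := by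
  by_cases h : ∃ i, μ.room i = r
  · obtain ⟨i, rfl⟩ := h
    refine (Finset.card_le_card (t := {i, μ.partner i}) fun j hj => ?_).trans Finset.card_le_two
    simpa using μ.room_pair i j (Finset.mem_filter.mp hj).2.symm
  · push Not at h
    simp [h]

open Classical in
/-- A triple meets the triples of at most six agents of a matching. -/
theorem card_filter_not_tripleDisj_le_six (μ : RMatching N R) (t : N × N × R) :
    (Finset.univ.filter fun i => ¬ TripleDisj (μ.triple i) t).card ≤ 6 := by
  have hsub : (Finset.univ.filter fun i => ¬ TripleDisj (μ.triple i) t) ⊆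
      {t.1, t.2.1, μ.partner t.1, μ.partner t.2.1} ∪
        Finset.univ.filter fun i => μ.room i = t.2.2 := by
    intro i hi
    have hp : ∀ x, μ.partner i = x → i = μ.partner x := by
      rintro x rfl
      exact (μ.partner_invol i).symm
    have h1 := hp t.1
    have h2 := hp t.2.1
    replace hi := (Finset.mem_filter.mp hi).2
    simp only [TripleDisj, triple] at hi
    simp only [Finset.mem_union, Finset.mem_insert, Finset.mem_singleton, Finset.mem_filter,
      Finset.mem_univ, true_and]
    tauto
  calc _ ≤ _ := Finset.card_le_card hsub
    _ ≤ _ := Finset.card_union_le _ _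
    _ ≤ 4 + 2 := add_le_add Finset.card_le_four (μ.card_filter_room_le_two _)

end RMatching

/-- Pairwise disjoint triples, as many as there are rooms, use every room. -/
theorem exists_get_room_eq {N R : Type*} [Fintype R] (ts : List (N × N × R))
    (hlen : ts.length = Fintype.card R)
    (hdisj : ∀ (k : ℕ) (hk : k < ts.length), ∀ t' ∈ ts.take k,
      TripleDisj (ts.get ⟨k, hk⟩) t') (r : R) :
    ∃ k : Fin ts.length, (ts.get k).2.2 = r := by
  have hlt : ∀ a b : Fin ts.length, a < b → (ts.get b).2.2 ≠ (ts.get a).2.2 := fun a b hab =>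
    (hdisj b b.2 (ts.get a) (List.mem_take_iff_getElem.mpr
      ⟨a, lt_min hab a.2, rfl⟩)).2.2.2.2
  have hinj : Function.Injective fun k : Fin ts.length => (ts.get k).2.2 := by
    intro a b hab
    rcases lt_trichotomy a b with h | h | h
    · exact absurd hab.symm (hlt a b h)
    · exact h
    · exact absurd hab (hlt b a h)
  exact ((Fintype.bijective_iff_injective_and_card _).mpr ⟨hinj, by simpa using hlen⟩).2 r

/-- For arbitrary nonnegative utilities over (roommate, room) pairs, any matching built
greedily — each triple maximizing the combined utility among the triples disjoint from the
previously chosen ones — achieves at least one third of the maximum social welfare. -/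
theorem triangle_then_L_one_third
    {N R : Type*} [Fintype N] [Fintype R] (n : ℕ)
    (hN : Fintype.card N = 2 * n) (hR : Fintype.card R = n)
    (u : N → N → R → ℝ) (hnn : ∀ i j r, 0 ≤ u i j r)
    (ts : List (N × N × R)) (hlen : ts.length = n)
    (hvalid : ∀ t ∈ ts, t.1 ≠ t.2.1)
    (hdisj : ∀ (k : ℕ) (hk : k < ts.length), ∀ t' ∈ ts.take k,
      TripleDisj (ts.get ⟨k, hk⟩) t')
    (hgreedy : ∀ (k : ℕ) (hk : k < ts.length), ∀ (i j : N) (r : R), i ≠ j →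
      (∀ t' ∈ ts.take k, TripleDisj (i, j, r) t') →
      tripleWeight u (i, j, r) ≤ tripleWeight u (ts.get ⟨k, hk⟩)) :
    ∀ μ' : RMatching N R,
      (1 / 3 : ℝ) * USWGen u μ' ≤ (ts.map (tripleWeight u)).sum := by
  classical
  intro μ'
  have hfirst : ∀ i, ∃ k : Fin ts.length, ¬ TripleDisj (μ'.triple i) (ts.get k) ∧
      tripleWeight u (μ'.triple i) ≤ tripleWeight u (ts.get k) := by
    intro i
    have hex : ∃ k, ∃ hk : k < ts.length, ¬ TripleDisj (μ'.triple i) (ts.get ⟨k, hk⟩) := by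
      obtain ⟨k, hk⟩ := exists_get_room_eq ts (hlen.trans hR.symm) hdisj (μ'.room i)
      exact ⟨k, k.2, fun h => h.2.2.2.2 hk.symm⟩
    obtain ⟨hk, hmeet⟩ := Nat.find_spec hex
    refine ⟨⟨Nat.find hex, hk⟩, hmeet,
      hgreedy _ hk i (μ'.partner i) (μ'.room i) (μ'.partner_ne i).symm fun t' ht' => ?_⟩
    obtain ⟨m, hm, rfl⟩ := List.mem_take_iff_getElem.mp ht'
    by_contra hnd
    exact Nat.find_min hex (lt_min_iff.mp hm).1 ⟨(lt_min_iff.mp hm).2, hnd⟩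
  choose f hmeet hle using hfirst
  have hw : ∀ t, 0 ≤ tripleWeight u t := fun t => add_nonneg (hnn _ _ _) (hnn _ _ _)
  have hsum : (ts.map (tripleWeight u)).sum = ∑ k : Fin ts.length, tripleWeight u (ts.get k) := by
    simp
  have hbound : 2 * USWGen u μ' ≤ 6 * (ts.map (tripleWeight u)).sum := by
    calc 2 * USWGen u μ' = ∑ i, tripleWeight u (μ'.triple i) := (μ'.sum_tripleWeight_triple u).symm
      _ ≤ ∑ i, tripleWeight u (ts.get (f i)) := Finset.sum_le_sum fun i _ => hle i
      _ = ∑ k, ∑ i with f i = k, tripleWeight u (ts.get (f i)) :=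
        (Finset.sum_fiberwise _ _ _).symm
      _ ≤ ∑ k, 6 * tripleWeight u (ts.get k) := Finset.sum_le_sum fun k _ => ?_
      _ = 6 * (ts.map (tripleWeight u)).sum := by rw [hsum, Finset.mul_sum]
    have hcard : (Finset.univ.filter fun i => f i = k).card ≤ 6 := by
      refine (Finset.card_le_card fun i hi => ?_).trans
        (μ'.card_filter_not_tripleDisj_le_six (ts.get k))
      obtain rfl := (Finset.mem_filter.mp hi).2
      exact Finset.mem_filter.mpr ⟨Finset.mem_univ _, hmeet i⟩
    rw [Finset.sum_congr rfl fun i hi => by rw [(Finset.mem_filter.mp hi).2],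
      Finset.sum_const, nsmul_eq_mul]
    exact mul_le_mul_of_nonneg_right (by exact_mod_cast hcard) (hw _)
  linarith
end

section
/- Under binary valuations and Leontief utilities, the Triangle-then-L (greedy) mechanism with a fixed deterministic tie-breaking rule is strategyproof: fix a linear order on triples used to break ties, and let G(profile) denote the matching obtained by repeatedly selecting the remaining triple of maximum reported combined Leontief utility (ties broken by the fixed linear order). Then for every binary profile, every agent i, and every binary unilateral misreport (v_i', v̂_i') by i, agent i's true Leontief utility in G of the true profile is at least its true Leontief utility in G of the misreported profile. -/
open scoped BigOperators

/-- Combined Leontief utility of the two agents of a triple. -/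
noncomputable def pairLeontief {N R : Type*} (v : N → N → ℝ) (vh : N → R → ℝ)
    (t : N × N × R) : ℝ :=
  min (v t.1 t.2.1) (vh t.1 t.2.2) + min (v t.2.1 t.1) (vh t.2.1 t.2.2)

/-- `t` is a candidate at step `k` of a greedy run `ts`: its two agents are distinct and
it is disjoint from the first `k` chosen triples. -/
def RemCand {N R : Type*} (ts : List (N × N × R)) (k : ℕ) (t : N × N × R) : Prop :=
  t.1 ≠ t.2.1 ∧ ∀ t' ∈ ts.take k, TripleDisj t t'

/-- `ts` is the run of the Triangle-then-L (greedy) mechanism on the reported profile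
`(v, vh)` with ties broken by the fixed linear order `tb`: it has `n` triples, and each
chosen triple is a candidate of maximum combined Leontief utility which is `tb`-least
among the tied maximizers. -/
noncomputable def GreedyRun {N R : Type*} (n : ℕ) (v : N → N → ℝ) (vh : N → R → ℝ)
    (tb : N × N × R → N × N × R → Prop) (ts : List (N × N × R)) : Prop :=
  ts.length = n ∧
  ∀ (k : ℕ) (hk : k < ts.length),
    RemCand ts k (ts.get ⟨k, hk⟩) ∧
    ∀ t', RemCand ts k t' →
      pairLeontief v vh t' ≤ pairLeontief v vh (ts.get ⟨k, hk⟩) ∧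
      (pairLeontief v vh t' = pairLeontief v vh (ts.get ⟨k, hk⟩) →
        t' = ts.get ⟨k, hk⟩ ∨ tb (ts.get ⟨k, hk⟩) t')

/-- The true Leontief utility of agent `a` in a list of triples. -/
noncomputable def listUtilL {N R : Type*} [DecidableEq N] (v : N → N → ℝ)
    (vh : N → R → ℝ) (a : N) (ts : List (N × N × R)) : ℝ :=
  (ts.map (fun t =>
    if a = t.1 then min (v a t.2.1) (vh a t.2.2)
    else if a = t.2.1 then min (v a t.1) (vh a t.2.2)
    else 0)).sum

/-- The utility of agent `a` in the triple `t`, and zero if `a` does not belong to `t`. -/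
noncomputable def tripleUtil {N R : Type*} [DecidableEq N] (v : N → N → ℝ)
    (vh : N → R → ℝ) (a : N) (t : N × N × R) : ℝ :=
  if a = t.1 then min (v a t.2.1) (vh a t.2.2)
  else if a = t.2.1 then min (v a t.1) (vh a t.2.2)
  else 0

section

variable {N R : Type*}

theorem GreedyRun.pairwise {n : ℕ} {v : N → N → ℝ} {vh : N → R → ℝ}
    {tb : N × N × R → N × N × R → Prop} {ts : List (N × N × R)}
    (h : GreedyRun n v vh tb ts) : ts.Pairwise fun t t' => TripleDisj t' t := by
  rw [List.pairwise_iff_getElem]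
  intro a b ha hb hab
  refine (h.2 b hb).1.2 _ ?_
  rw [List.mem_take_iff_getElem]
  exact ⟨a, by omega, rfl⟩

theorem Binary.min_eq_zero_or_one {v : N → N → ℝ} {vh : N → R → ℝ} (h : Binary v vh)
    (a b : N) (r : R) : min (v a b) (vh a r) = 0 ∨ min (v a b) (vh a r) = 1 := by
  rcases h.1 a b with h1 | h1 <;> rcases h.2 a r with h2 | h2 <;> simp [h1, h2]

variable [DecidableEq N]

theorem listUtilL_cons (v : N → N → ℝ) (vh : N → R → ℝ) (a : N) (t : N × N × R)
    (ts : List (N × N × R)) :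
    listUtilL v vh a (t :: ts) = tripleUtil v vh a t + listUtilL v vh a ts := by
  simp [listUtilL, tripleUtil]

theorem listUtilL_eq_zero (v : N → N → ℝ) (vh : N → R → ℝ) {a : N}
    {ts : List (N × N × R)} (h : ∀ t ∈ ts, a ≠ t.1 ∧ a ≠ t.2.1) :
    listUtilL v vh a ts = 0 := by
  induction ts with
  | nil => simp [listUtilL]
  | cons s ts ih =>
    rw [listUtilL_cons, ih fun t ht => h t (List.mem_cons_of_mem _ ht)]
    simp [tripleUtil, h s List.mem_cons_self]

theorem listUtilL_eq_tripleUtil (v : N → N → ℝ) (vh : N → R → ℝ) {a : N}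
    {ts : List (N × N × R)} (hts : ts.Pairwise fun t t' => TripleDisj t' t)
    {t : N × N × R} (ht : t ∈ ts) (ha : a = t.1 ∨ a = t.2.1) :
    listUtilL v vh a ts = tripleUtil v vh a t := by
  induction ts with
  | nil => simp at ht
  | cons s ts ih =>
    rw [listUtilL_cons]
    rw [List.pairwise_cons] at hts
    rcases List.mem_cons.1 ht with rfl | ht
    · rw [listUtilL_eq_zero, add_zero]
      intro t' ht'
      obtain ⟨h1, h2, h3, h4, -⟩ := hts.1 t' ht'
      grind
    · obtain ⟨h1, h2, h3, h4, -⟩ := hts.1 t ht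
      rw [ih hts.2 ht, add_eq_right, tripleUtil]
      grind

theorem Binary.tripleUtil_eq_zero_or_one {v : N → N → ℝ} {vh : N → R → ℝ}
    (h : Binary v vh) (a : N) (t : N × N × R) :
    tripleUtil v vh a t = 0 ∨ tripleUtil v vh a t = 1 := by
  unfold tripleUtil
  split_ifs
  · exact h.min_eq_zero_or_one _ _ _
  · exact h.min_eq_zero_or_one _ _ _
  · exact Or.inl rfl

theorem Binary.listUtilL_eq_zero_or_one {v : N → N → ℝ} {vh : N → R → ℝ}
    (h : Binary v vh) (a : N) {ts : List (N × N × R)}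
    (hts : ts.Pairwise fun t t' => TripleDisj t' t) :
    listUtilL v vh a ts = 0 ∨ listUtilL v vh a ts = 1 := by
  by_cases hex : ∃ t ∈ ts, a = t.1 ∨ a = t.2.1
  · obtain ⟨t, ht, ha⟩ := hex
    rw [listUtilL_eq_tripleUtil v vh hts ht ha]
    exact h.tripleUtil_eq_zero_or_one a t
  · push Not at hex
    exact Or.inl (listUtilL_eq_zero v vh hex)

/-- A unilateral misreport changes the weight of a triple by the change in the utility of
the misreporting agent. -/
theorem pairLeontief_update_sub (v : N → N → ℝ) (vh : N → R → ℝ) (a : N) (va' : N → ℝ)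
    (vha' : R → ℝ) {t : N × N × R} (ht : t.1 ≠ t.2.1) :
    pairLeontief (Function.update v a va') (Function.update vh a vha') t
        - pairLeontief v vh t =
      tripleUtil (Function.update v a va') (Function.update vh a vha') a t
        - tripleUtil v vh a t := by
  unfold pairLeontief tripleUtil
  by_cases h1 : a = t.1
  · subst h1
    simp [Function.update_of_ne ht.symm]
  · by_cases h2 : a = t.2.1
    · subst h2
      simp [Function.update_of_ne ht, ht.symm]
    · simp [Function.update_of_ne (Ne.symm h1), Function.update_of_ne (Ne.symm h2), h1, h2]

theorem Binary.update {v : N → N → ℝ} {vh : N → R → ℝ} (h : Binary v vh) (a : N)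
    {va' : N → ℝ} {vha' : R → ℝ} (hv : ∀ j, va' j = 0 ∨ va' j = 1)
    (hvh : ∀ r, vha' r = 0 ∨ vha' r = 1) :
    Binary (Function.update v a va') (Function.update vh a vha') := by
  constructor <;> intro b c <;> by_cases hb : b = a
  · subst hb; simpa using hv c
  · simpa [Function.update_of_ne hb] using h.1 b c
  · subst hb; simpa using hvh c
  · simpa [Function.update_of_ne hb] using h.2 b c

theorem tripleUtil_eq_zero (v : N → N → ℝ) (vh : N → R → ℝ) {a : N} {t : N × N × R}
    (h : ¬(a = t.1 ∨ a = t.2.1)) : tripleUtil v vh a t = 0 := by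
  rw [not_or] at h
  simp [tripleUtil, h]

end

/-- Under binary Leontief utilities, the Triangle-then-L (greedy) mechanism with a fixed
deterministic tie-breaking linear order `tb` on triples is strategyproof: an agent's true
Leontief utility under the greedy run on the true profile is at least its true utility
under the greedy run on any unilateral binary misreport. -/
theorem greedy_strategyproof_binary_leontief
    {N R : Type*} [Fintype N] [Fintype R] [DecidableEq N] (n : ℕ)
    (hN : Fintype.card N = 2 * n) (hR : Fintype.card R = n)
    (tb : N × N × R → N × N × R → Prop) (htb : IsLinearOrder (N × N × R) tb)
    (v : N → N → ℝ) (vh : N → R → ℝ) (hbin : Binary v vh)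
    (i : N) (vi' : N → ℝ) (vhi' : R → ℝ)
    (hvi' : ∀ j, vi' j = 0 ∨ vi' j = 1) (hvhi' : ∀ r, vhi' r = 0 ∨ vhi' r = 1)
    (ts ts' : List (N × N × R))
    (hts : GreedyRun n v vh tb ts)
    (hts' : GreedyRun n (Function.update v i vi') (Function.update vh i vhi') tb ts') :
    listUtilL v vh i ts' ≤ listUtilL v vh i ts := by
  have hbin' := hbin.update i hvi' hvhi'
  have hp := hts.pairwise
  have hp' := hts'.pairwise
  rcases hbin.listUtilL_eq_zero_or_one i hp with hU | hU <;>
    rcases hbin.listUtilL_eq_zero_or_one i hp' with hU' | hU' <;>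
    rw [hU, hU'] <;> norm_num
  have hne : ts ≠ ts' := by
    rintro rfl
    linarith
  have hlen : ts.length = ts'.length := hts.1.trans hts'.1.symm
  have hex : ∃ k : ℕ, ts[k]? ≠ ts'[k]? := by
    by_contra! hall
    exact hne (List.ext_getElem? hall)
  classical
  -- the first step at which the two runs differ
  obtain ⟨k, hk, hmin⟩ : ∃ k : ℕ, ts[k]? ≠ ts'[k]? ∧ ∀ m < k, ts[m]? = ts'[m]? :=
    ⟨Nat.find hex, Nat.find_spec hex, fun m hm => not_not.1 (Nat.find_min hex hm)⟩
  have hk1 : k < ts.length := by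
    by_contra hge
    apply hk
    rw [List.getElem?_eq_none (by omega), List.getElem?_eq_none (by omega)]
  have hk2 : k < ts'.length := hlen ▸ hk1
  have htake : ts.take k = ts'.take k := by
    apply List.ext_getElem?
    intro m
    rw [List.getElem?_take, List.getElem?_take]
    split_ifs with hm
    · exact hmin m hm
    · rfl
  obtain ⟨hc, hopt⟩ := hts.2 k hk1
  obtain ⟨hc', hopt'⟩ := hts'.2 k hk2
  have hmem : ts.get ⟨k, hk1⟩ ∈ ts := List.get_mem _ _
  have hmem' : ts'.get ⟨k, hk2⟩ ∈ ts' := List.get_mem _ _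
  have htne : ts.get ⟨k, hk1⟩ ≠ ts'.get ⟨k, hk2⟩ := by
    intro heq
    apply hk
    rw [List.getElem?_eq_getElem hk1, List.getElem?_eq_getElem hk2]
    exact congrArg some heq
  generalize ts.get ⟨k, hk1⟩ = t at *
  generalize ts'.get ⟨k, hk2⟩ = t' at *
  obtain ⟨hle, htie⟩ := hopt t' (by simpa only [RemCand, htake] using hc')
  obtain ⟨hle', htie'⟩ := hopt' t (by simpa only [RemCand, htake] using hc)
  have hsub := pairLeontief_update_sub v vh i vi' vhi' hc.1
  have hsub' := pairLeontief_update_sub v vh i vi' vhi' hc'.1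
  have hw : pairLeontief v vh t ≤
      pairLeontief (Function.update v i vi') (Function.update vh i vhi') t := by
    have h0 : tripleUtil v vh i t = 0 := by
      by_cases hi : i = t.1 ∨ i = t.2.1
      · rw [← listUtilL_eq_tripleUtil v vh hp hmem hi, hU]
      · exact tripleUtil_eq_zero v vh hi
    rcases hbin'.tripleUtil_eq_zero_or_one i t with h | h <;> linarith
  have hw' : pairLeontief (Function.update v i vi') (Function.update vh i vhi') t' ≤
      pairLeontief v vh t' := by
    by_cases hi : i = t'.1 ∨ i = t'.2.1
    · have h1 := listUtilL_eq_tripleUtil v vh hp' hmem' hi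
      rcases hbin'.tripleUtil_eq_zero_or_one i t' with h | h <;> linarith
    · have h1 := tripleUtil_eq_zero v vh hi
      have h2 := tripleUtil_eq_zero (Function.update v i vi') (Function.update vh i vhi') hi
      linarith
  have h1 := (htie (by linarith)).resolve_left htne.symm
  have h2 := (htie' (by linarith)).resolve_left htne
  exact htne (htb.antisymm _ _ h1 h2)
end

section
/- Under binary valuations and additive utilities, the Welfare-Prioritized Serial Dictatorship mechanism is strategyproof and achieves at least one seventh of the maximum social welfare. Precisely: fix a priority ordering σ over the agents together with deterministic tie-breaking rules; agents are called in order; a called unmatched agent i with positive reported value for some remaining (agent, room) pair selects a remaining agent j maximizing v_i(j) and a remaining room r maximizing v̂_i(r) (ties broken by the fixed rules, depending only on i's reported valuations and the remaining agents and rooms), forming the triple (i, j, r); agents with zero value for everything remaining are set aside and, together with the remaining rooms, are matched at the end by a fixed report-independent rule. Then: (a) for every binary profile, every agent i, and every binary unilateral misreport, agent i's true additive utility under the truthful outcome is at least its true additive utility under the misreported outcome; and (b) the output matching μ satisfies USW(μ) ≥ (1/7) · max_{μ'} USW(μ'). -/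
open scoped BigOperators
open scoped Classical

/-- The true additive utility of agent `a` in a list of triples. -/
noncomputable def listUtilA {N R : Type*} [DecidableEq N] (v : N → N → ℝ)
    (vh : N → R → ℝ) (a : N) (ts : List (N × N × R)) : ℝ :=
  (ts.map (fun t =>
    if a = t.1 then v a t.2.1 + vh a t.2.2
    else if a = t.2.1 then v a t.1 + vh a t.2.2
    else 0)).sum

/-- The dictatorship phase of the Welfare-Prioritized Serial Dictatorship mechanism:
agents are called in the priority order; a still-unmatched called agent `a` with positive
reported value for some remaining (agent, room) pair is matched into the triple given by
its selection rule `sel` (a function of its own reported valuations and the remaining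
agents and rooms only); agents with zero value for everything remaining are set aside. -/
noncomputable def wpsdRun {N R : Type*} [DecidableEq N] [DecidableEq R]
    (sel : N → (N → ℝ) → (R → ℝ) → Finset N → Finset R → N × R)
    (v : N → N → ℝ) (vh : N → R → ℝ) :
    List N → Finset N → Finset R → List (N × N × R)
  | [], _, _ => []
  | a :: L, A, B =>
    if a ∈ A ∧ ∃ j ∈ A.erase a, ∃ r ∈ B, 0 < v a j + vh a r then
      (a, (sel a (v a) (vh a) (A.erase a) B).1, (sel a (v a) (vh a) (A.erase a) B).2) ::
        wpsdRun sel v vh L ((A.erase a).erase (sel a (v a) (vh a) (A.erase a) B).1)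
          (B.erase (sel a (v a) (vh a) (A.erase a) B).2)
    else wpsdRun sel v vh L A B

/-- Unmatched agents after a partial run. -/
def leftA {N R : Type*} [Fintype N] [DecidableEq N] (ts : List (N × N × R)) : Finset N :=
  Finset.univ.filter fun a => ∀ t ∈ ts, a ≠ t.1 ∧ a ≠ t.2.1

/-- Unmatched rooms after a partial run. -/
def leftR {N R : Type*} [Fintype R] [DecidableEq R] (ts : List (N × N × R)) : Finset R :=
  Finset.univ.filter fun r => ∀ t ∈ ts, r ≠ t.2.2

/-- The full output of the Welfare-Prioritized Serial Dictatorship mechanism: the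
dictatorship phase followed by the (report-independent) completion rule `comp` on the
leftover agents and rooms. -/
noncomputable def wpsdOutput {N R : Type*} [Fintype N] [Fintype R]
    [DecidableEq N] [DecidableEq R]
    (sel : N → (N → ℝ) → (R → ℝ) → Finset N → Finset R → N × R)
    (comp : Finset N → Finset R → List (N × N × R))
    (v : N → N → ℝ) (vh : N → R → ℝ) (L : List N) : List (N × N × R) :=
  wpsdRun sel v vh L Finset.univ Finset.univ ++
    comp (leftA (wpsdRun sel v vh L Finset.univ Finset.univ))
      (leftR (wpsdRun sel v vh L Finset.univ Finset.univ))

section ListUtility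

variable {N R : Type*} [DecidableEq N] {v : N → N → ℝ} {vh : N → R → ℝ}

theorem listUtilA_cons (a : N) (t : N × N × R) (ts : List (N × N × R)) :
    listUtilA v vh a (t :: ts) =
      (if a = t.1 then v a t.2.1 + vh a t.2.2
        else if a = t.2.1 then v a t.1 + vh a t.2.2 else 0) + listUtilA v vh a ts := by
  simp [listUtilA]

theorem listUtilA_nonneg (hv : ∀ i j, 0 ≤ v i j) (hvh : ∀ i r, 0 ≤ vh i r) (a : N)
    (ts : List (N × N × R)) : 0 ≤ listUtilA v vh a ts := by
  induction ts with
  | nil => simp [listUtilA]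
  | cons t ts ih =>
    rw [listUtilA_cons]
    have h1 := hv a t.2.1
    have h2 := hv a t.1
    have h3 := hvh a t.2.2
    split_ifs <;> linarith

theorem listUtilA_eq_zero {a : N} {ts : List (N × N × R)}
    (h : ∀ t ∈ ts, a ≠ t.1 ∧ a ≠ t.2.1) : listUtilA v vh a ts = 0 := by
  induction ts with
  | nil => simp [listUtilA]
  | cons t ts ih =>
    rw [listUtilA_cons, ih fun s hs => h s (List.mem_cons_of_mem _ hs)]
    simp [h t List.mem_cons_self]

/-- In a list of disjoint triples, an agent's utility is bounded by any bound on its utility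
in a single triple. -/
theorem listUtilA_le {a : N} {M : ℝ} (hM : 0 ≤ M) {ts : List (N × N × R)}
    (hd : ts.Pairwise TripleDisj)
    (h₁ : ∀ t ∈ ts, a = t.1 → v a t.2.1 + vh a t.2.2 ≤ M)
    (h₂ : ∀ t ∈ ts, a = t.2.1 → v a t.1 + vh a t.2.2 ≤ M) :
    listUtilA v vh a ts ≤ M := by
  induction ts with
  | nil => simpa [listUtilA] using hM
  | cons t ts ih =>
    rw [List.pairwise_cons] at hd
    rw [listUtilA_cons]
    by_cases ha : a = t.1 ∨ a = t.2.1
    · have hrest : listUtilA v vh a ts = 0 := by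
        refine listUtilA_eq_zero fun s hs => ?_
        obtain ⟨d1, d2, d3, d4, -⟩ := hd.1 s hs
        rcases ha with rfl | rfl
        · exact ⟨d1, d2⟩
        · exact ⟨d3, d4⟩
      have b1 := h₁ t List.mem_cons_self
      have b2 := h₂ t List.mem_cons_self
      rw [hrest]
      split_ifs with c1 c2
      · linarith [b1 c1]
      · linarith [b2 c2]
      · linarith
    · push Not at ha
      have := ih hd.2 (fun s hs => h₁ s (List.mem_cons_of_mem _ hs))
        (fun s hs => h₂ s (List.mem_cons_of_mem _ hs))
      simpa [ha.1, ha.2] using this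

/-- Total utility is at least the utility collected by the first agents of the triples. -/
theorem sum_first_le_sum_listUtilA [Fintype N] (hv : ∀ i j, 0 ≤ v i j)
    (hvh : ∀ i r, 0 ≤ vh i r) (ts : List (N × N × R)) :
    (ts.map fun t => v t.1 t.2.1 + vh t.1 t.2.2).sum ≤ ∑ a, listUtilA v vh a ts := by
  induction ts with
  | nil => simp [listUtilA]
  | cons t ts ih =>
    simp_rw [listUtilA_cons, Finset.sum_add_distrib]
    rw [List.map_cons, List.sum_cons]
    refine add_le_add ?_ ih
    have h := Finset.single_le_sum (s := Finset.univ)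
      (f := fun a => if a = t.1 then v a t.2.1 + vh a t.2.2
        else if a = t.2.1 then v a t.1 + vh a t.2.2 else 0)
      (fun a _ => by
        have h1 := hv a t.2.1
        have h2 := hv a t.1
        have h3 := hvh a t.2.2
        split_ifs <;> linarith)
      (Finset.mem_univ t.1)
    simpa using h

end ListUtility

section Balanced

variable {N R : Type*} [DecidableEq N] {v : N → N → ℝ} {vh : N → R → ℝ}

/-- `ts` consists of disjoint triples of agents in `A` and rooms in `B`. -/
def TriplesIn (A : Finset N) (B : Finset R) (ts : List (N × N × R)) : Prop :=
  (∀ t ∈ ts, t.1 ∈ A ∧ t.2.1 ∈ A ∧ t.2.2 ∈ B ∧ t.1 ≠ t.2.1) ∧ ts.Pairwise TripleDisj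

theorem TriplesIn.listUtilA_le {A : Finset N} {B : Finset R} {ts : List (N × N × R)}
    (h : TriplesIn A B ts) {i : N} {M : ℝ} (hM : 0 ≤ M)
    (hle : ∀ j ∈ A.erase i, ∀ r ∈ B, v i j + vh i r ≤ M) : listUtilA v vh i ts ≤ M := by
  refine _root_.listUtilA_le hM h.2 (fun t ht hi => ?_) (fun t ht hi => ?_)
  · obtain ⟨-, h2, h3, h4⟩ := h.1 t ht
    exact hle _ (Finset.mem_erase.2 ⟨hi ▸ h4.symm, h2⟩) _ h3
  · obtain ⟨h1, -, h3, h4⟩ := h.1 t ht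
    exact hle _ (Finset.mem_erase.2 ⟨hi ▸ h4, h1⟩) _ h3

theorem exists_mem_erase_and_mem {A : Finset N} {B : Finset R} {i : N}
    (hc : A.card = 2 * B.card) (hi : i ∈ A) : (∃ j, j ∈ A.erase i) ∧ ∃ r, r ∈ B := by
  have hA : 0 < A.card := Finset.card_pos.2 ⟨i, hi⟩
  refine ⟨Finset.card_pos.1 ?_, Finset.card_pos.1 (by omega)⟩
  rw [Finset.card_erase_of_mem hi]
  omega

theorem sum_ite_partner_le (μ : RMatching N R) (A : Finset N) (a : N) :
    ∑ i ∈ A, (if μ.partner i = a then (1 : ℝ) else 0) ≤ 1 := by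
  rw [Finset.sum_boole]
  have hcard : (A.filter fun i => μ.partner i = a).card ≤ 1 := by
    rw [Finset.card_le_one]
    intro x hx y hy
    rw [← μ.partner_invol x, ← μ.partner_invol y, (Finset.mem_filter.1 hx).2,
      (Finset.mem_filter.1 hy).2]
  exact_mod_cast hcard

end Balanced

section Mechanism

variable {N R : Type*} [DecidableEq N] [DecidableEq R]

/-- The full mechanism started from the remaining agents `A` and rooms `B`. -/
noncomputable def wpsdFrom
    (sel : N → (N → ℝ) → (R → ℝ) → Finset N → Finset R → N × R)
    (comp : Finset N → Finset R → List (N × N × R))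
    (v : N → N → ℝ) (vh : N → R → ℝ) :
    List N → Finset N → Finset R → List (N × N × R)
  | [], A, B => comp A B
  | a :: L, A, B =>
    if a ∈ A ∧ ∃ j ∈ A.erase a, ∃ r ∈ B, 0 < v a j + vh a r then
      (a, (sel a (v a) (vh a) (A.erase a) B).1, (sel a (v a) (vh a) (A.erase a) B).2) ::
        wpsdFrom sel comp v vh L ((A.erase a).erase (sel a (v a) (vh a) (A.erase a) B).1)
          (B.erase (sel a (v a) (vh a) (A.erase a) B).2)
    else wpsdFrom sel comp v vh L A B

/-- `sel` picks a best remaining agent and a best remaining room. -/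
def ValidSel (sel : N → (N → ℝ) → (R → ℝ) → Finset N → Finset R → N × R) : Prop :=
  ∀ (a : N) (va : N → ℝ) (vha : R → ℝ) (A : Finset N) (B : Finset R),
    (∃ j ∈ A, ∃ r ∈ B, 0 < va j + vha r) →
    (sel a va vha A B).1 ∈ A ∧ (sel a va vha A B).2 ∈ B ∧
      (∀ j ∈ A, va j ≤ va (sel a va vha A B).1) ∧
      (∀ r ∈ B, vha r ≤ vha (sel a va vha A B).2)

variable {sel : N → (N → ℝ) → (R → ℝ) → Finset N → Finset R → N × R}
  {comp : Finset N → Finset R → List (N × N × R)} {v : N → N → ℝ} {vh : N → R → ℝ}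

theorem wpsdFrom_eq_append (L : List N) (A : Finset N) (B : Finset R) :
    wpsdFrom sel comp v vh L A B = wpsdRun sel v vh L A B ++
      comp (A.filter fun a => ∀ t ∈ wpsdRun sel v vh L A B, a ≠ t.1 ∧ a ≠ t.2.1)
        (B.filter fun r => ∀ t ∈ wpsdRun sel v vh L A B, r ≠ t.2.2) := by
  induction L generalizing A B with
  | nil => simp [wpsdFrom, wpsdRun]
  | cons a L ih =>
    rw [wpsdFrom, wpsdRun]
    split_ifs with h
    · rw [ih, List.cons_append]
      congr 3
      · ext x
        simp only [Finset.mem_filter, Finset.mem_erase, List.forall_mem_cons]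
        tauto
      · ext x
        simp only [Finset.mem_filter, Finset.mem_erase, List.forall_mem_cons]
        tauto
    · exact ih A B

theorem wpsdOutput_eq_wpsdFrom [Fintype N] [Fintype R] (L : List N) :
    wpsdOutput sel comp v vh L = wpsdFrom sel comp v vh L Finset.univ Finset.univ := by
  rw [wpsdFrom_eq_append, wpsdOutput, leftA, leftR]

theorem card_erase_erase {A : Finset N} {B : Finset R} {a j : N} {r : R}
    (hc : A.card = 2 * B.card) (ha : a ∈ A) (hj : j ∈ A.erase a) (hr : r ∈ B) :
    ((A.erase a).erase j).card = 2 * (B.erase r).card := by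
  rw [Finset.card_erase_of_mem hj, Finset.card_erase_of_mem ha, Finset.card_erase_of_mem hr]
  omega

theorem wpsdFrom_triplesIn (hsel : ValidSel sel)
    (hcomp : ∀ (A : Finset N) (B : Finset R), A.card = 2 * B.card → TriplesIn A B (comp A B))
    (L : List N) {A : Finset N} {B : Finset R} (hc : A.card = 2 * B.card) :
    TriplesIn A B (wpsdFrom sel comp v vh L A B) := by
  induction L generalizing A B with
  | nil => exact hcomp A B hc
  | cons a L ih =>
    rw [wpsdFrom]
    split_ifs with h
    · obtain ⟨hj, hr, -, -⟩ := hsel a (v a) (vh a) (A.erase a) B h.2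
      generalize sel a (v a) (vh a) (A.erase a) B = s at hj hr ⊢
      obtain ⟨h1, h2⟩ := ih (card_erase_erase hc h.1 hj hr)
      simp only [Finset.mem_erase] at h1 hj
      refine ⟨List.forall_mem_cons.2 ⟨⟨h.1, hj.2, hr, hj.1.symm⟩, fun t ht => ?_⟩,
        List.pairwise_cons.2 ⟨fun t ht => ?_, h2⟩⟩
      · obtain ⟨⟨-, -, h3⟩, ⟨-, -, h4⟩, ⟨-, h5⟩, h6⟩ := h1 t ht
        exact ⟨h3, h4, h5, h6⟩
      · obtain ⟨⟨h3, h4, -⟩, ⟨h5, h6, -⟩, ⟨h7, -⟩, -⟩ := h1 t ht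
        exact ⟨h4.symm, h6.symm, h3.symm, h5.symm, h7.symm⟩
    · exact ih hc

/-- Misreporting does not help, from any balanced intermediate state of the mechanism. -/
theorem wpsdFrom_strategyproof (hsel : ValidSel sel)
    (hcomp : ∀ (A : Finset N) (B : Finset R), A.card = 2 * B.card → TriplesIn A B (comp A B))
    (hv : ∀ i j, 0 ≤ v i j) (hvh : ∀ i r, 0 ≤ vh i r) (i : N) (vi : N → ℝ) (vhi : R → ℝ)
    (L : List N) {A : Finset N} {B : Finset R} (hc : A.card = 2 * B.card) :
    listUtilA v vh i
        (wpsdFrom sel comp (Function.update v i vi) (Function.update vh i vhi) L A B) ≤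
      listUtilA v vh i (wpsdFrom sel comp v vh L A B) := by
  induction L generalizing A B with
  | nil => rfl
  | cons a L ih =>
    by_cases hai : a = i
    · subst hai
      by_cases ha : a ∈ A
      · have hmis := wpsdFrom_triplesIn (v := Function.update v a vi)
          (vh := Function.update vh a vhi) hsel hcomp (a :: L) hc
        by_cases hpos : ∃ j ∈ A.erase a, ∃ r ∈ B, 0 < v a j + vh a r
        · obtain ⟨-, -, hjmax, hrmax⟩ := hsel a (v a) (vh a) (A.erase a) B hpos
          refine (hmis.listUtilA_le (add_nonneg (hv a _) (hvh a _)) fun j hj r hr =>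
            add_le_add (hjmax j hj) (hrmax r hr)).trans ?_
          rw [wpsdFrom, if_pos ⟨ha, hpos⟩, listUtilA_cons, if_pos rfl]
          exact le_add_of_nonneg_right (listUtilA_nonneg hv hvh _ _)
        · push Not at hpos
          exact (hmis.listUtilA_le le_rfl hpos).trans (listUtilA_nonneg hv hvh _ _)
      · simp only [wpsdFrom, ha, false_and, if_false]
        exact ih hc
    · rw [wpsdFrom, wpsdFrom, Function.update_of_ne hai, Function.update_of_ne hai]
      split_ifs with h
      · obtain ⟨hj, hr, -, -⟩ := hsel a (v a) (vh a) (A.erase a) B h.2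
        rw [listUtilA_cons, listUtilA_cons]
        exact add_le_add_right (ih (card_erase_erase hc h.1 hj hr)) _
      · exact ih hc

end Mechanism

section Welfare

variable {N R : Type*} [DecidableEq N] [DecidableEq R] {v : N → N → ℝ} {vh : N → R → ℝ}

/-- The part of agent `i`'s utility in `μ` that is still available when only the agents in `A`
and the rooms in `B` remain. -/
noncomputable def availUtil (v : N → N → ℝ) (vh : N → R → ℝ) (μ : RMatching N R)
    (A : Finset N) (B : Finset R) (i : N) : ℝ :=
  (if μ.partner i ∈ A then v i (μ.partner i) else 0) +
    (if μ.room i ∈ B then vh i (μ.room i) else 0)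

theorem availUtil_le (hv : ∀ i j, 0 ≤ v i j) (hvh : ∀ i r, 0 ≤ vh i r) (μ : RMatching N R)
    {A : Finset N} {B : Finset R} {i : N} {M : ℝ} (hc : A.card = 2 * B.card) (hi : i ∈ A)
    (hle : ∀ j ∈ A.erase i, ∀ r ∈ B, v i j + vh i r ≤ M) : availUtil v vh μ A B i ≤ M := by
  obtain ⟨⟨j, hj⟩, r, hr⟩ := exists_mem_erase_and_mem hc hi
  have hp : μ.partner i ∈ A → μ.partner i ∈ A.erase i := fun h =>
    Finset.mem_erase.2 ⟨μ.partner_ne i, h⟩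
  have h1 := hv i j
  have h2 := hvh i r
  unfold availUtil
  split_ifs with c1 c2 c2
  · exact hle _ (hp c1) _ c2
  · linarith [hle _ (hp c1) _ hr]
  · linarith [hle _ hj _ c2]
  · linarith [hle _ hj _ hr]

theorem sum_ite_room_le (μ : RMatching N R) (A : Finset N) (r : R) :
    ∑ i ∈ A, (if μ.room i = r then (1 : ℝ) else 0) ≤ 2 := by
  rw [Finset.sum_boole]
  have hcard : (A.filter fun i => μ.room i = r).card ≤ 2 := by
    rcases (A.filter fun i => μ.room i = r).eq_empty_or_nonempty with h | ⟨k, hk⟩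
    · simp [h]
    · refine (Finset.card_le_card (t := {k, μ.partner k}) fun x hx => ?_).trans
        Finset.card_le_two
      have := μ.room_pair k x ((Finset.mem_filter.1 hk).2.trans (Finset.mem_filter.1 hx).2.symm)
      simpa using this
  exact_mod_cast hcard

/-- Forming one triple destroys at most `6` units of available utility in addition to that of
the agent choosing it. -/
theorem sum_availUtil_le (hv : ∀ i j, v i j ≤ 1)
    (hvh : ∀ i r, vh i r ≤ 1) (μ : RMatching N R) {A : Finset N} {B : Finset R} {a j : N}
    {r : R} (ha : a ∈ A) (hj : j ∈ A.erase a) :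
    ∑ i ∈ A, availUtil v vh μ A B i ≤ availUtil v vh μ A B a + 6 +
      ∑ i ∈ (A.erase a).erase j,
        availUtil v vh μ ((A.erase a).erase j) (B.erase r) i := by
  rw [← Finset.add_sum_erase A _ ha, ← Finset.add_sum_erase (A.erase a) _ hj]
  have hj2 : availUtil v vh μ A B j ≤ 2 := by
    have h1 := hv j (μ.partner j)
    have h2 := hvh j (μ.room j)
    unfold availUtil
    split_ifs <;> linarith
  have hterm : ∀ i, availUtil v vh μ A B i ≤
      availUtil v vh μ ((A.erase a).erase j) (B.erase r) i +
        (if μ.partner i = a then 1 else 0) + (if μ.partner i = j then 1 else 0) +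
        (if μ.room i = r then 1 else 0) := by
    intro i
    have h1 := hv i (μ.partner i)
    have h2 := hvh i (μ.room i)
    have hP : (if μ.partner i ∈ A then v i (μ.partner i) else 0) ≤
        (if μ.partner i ∈ (A.erase a).erase j then v i (μ.partner i) else 0) +
          (if μ.partner i = a then 1 else 0) + (if μ.partner i = j then 1 else 0) := by
      simp only [Finset.mem_erase]
      split_ifs <;> first | linarith | (exfalso; tauto)
    have hQ : (if μ.room i ∈ B then vh i (μ.room i) else 0) ≤
        (if μ.room i ∈ B.erase r then vh i (μ.room i) else 0) +
          (if μ.room i = r then 1 else 0) := by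
      simp only [Finset.mem_erase]
      split_ifs <;> first | linarith | (exfalso; tauto)
    unfold availUtil
    linarith
  have hsum := Finset.sum_le_sum fun i (_ : i ∈ (A.erase a).erase j) => hterm i
  simp only [Finset.sum_add_distrib] at hsum
  have s1 := sum_ite_partner_le μ ((A.erase a).erase j) a
  have s2 := sum_ite_partner_le μ ((A.erase a).erase j) j
  have s3 := sum_ite_room_le μ ((A.erase a).erase j) r
  linarith

/-- From any balanced intermediate state in which the agents already called are worthless for
themselves, the mechanism collects a seventh of the available utility of `μ`. -/
theorem sum_availUtil_le_wpsdFrom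
    {sel : N → (N → ℝ) → (R → ℝ) → Finset N → Finset R → N × R}
    {comp : Finset N → Finset R → List (N × N × R)} (hsel : ValidSel sel)
    (hbin : Binary v vh) (μ : RMatching N R) (L : List N) {A : Finset N} {B : Finset R}
    (hc : A.card = 2 * B.card)
    (hzero : ∀ i ∈ A, i ∉ L → ∀ j ∈ A.erase i, ∀ r ∈ B, v i j + vh i r ≤ 0) :
    ∑ i ∈ A, availUtil v vh μ A B i ≤
      7 * ((wpsdFrom sel comp v vh L A B).map fun t => v t.1 t.2.1 + vh t.1 t.2.2).sum := by
  have hv0 : ∀ i j, 0 ≤ v i j := fun i j => by rcases hbin.1 i j with h | h <;> simp [h]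
  have hvh0 : ∀ i r, 0 ≤ vh i r := fun i r => by rcases hbin.2 i r with h | h <;> simp [h]
  have hv1 : ∀ i j, v i j ≤ 1 := fun i j => by rcases hbin.1 i j with h | h <;> simp [h]
  have hvh1 : ∀ i r, vh i r ≤ 1 := fun i r => by rcases hbin.2 i r with h | h <;> simp [h]
  induction L generalizing A B with
  | nil =>
    refine (Finset.sum_nonpos fun i hi =>
      availUtil_le hv0 hvh0 μ hc hi (hzero i hi List.not_mem_nil)).trans ?_
    refine mul_nonneg (by norm_num) (List.sum_nonneg fun x hx => ?_)
    obtain ⟨t, -, rfl⟩ := List.mem_map.1 hx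
    exact add_nonneg (hv0 _ _) (hvh0 _ _)
  | cons a L ih =>
    rw [wpsdFrom]
    split_ifs with h
    · obtain ⟨hj, hr, hjmax, hrmax⟩ := hsel a (v a) (vh a) (A.erase a) B h.2
      obtain ⟨j', hj', r', hr', hpos⟩ := h.2
      generalize sel a (v a) (vh a) (A.erase a) B = s at hj hr hjmax hrmax ⊢
      have hgain : 1 ≤ v a s.1 + vh a s.2 := by
        have h1 := hjmax j' hj'
        have h2 := hrmax r' hr'
        rcases hbin.1 a s.1 with h3 | h3 <;> rcases hbin.2 a s.2 with h4 | h4 <;> linarith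
      have ha := availUtil_le hv0 hvh0 μ hc h.1 fun j hj r hr =>
        add_le_add (hjmax j hj) (hrmax r hr)
      have hstep := sum_availUtil_le (B := B) (r := s.2) hv1 hvh1 μ h.1 hj
      have hrec := ih (card_erase_erase hc h.1 hj hr) fun i hi hiL j hj' r hr' => by
        simp only [Finset.mem_erase] at hi hj' hr'
        exact hzero i hi.2.2 (by simp [hi.2.1, hiL]) j
          (Finset.mem_erase.2 ⟨hj'.1, hj'.2.2.2⟩) r hr'.2
      rw [List.map_cons, List.sum_cons]
      linarith
    · refine ih hc fun i hi hiL j hj r hr => ?_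
      by_cases hia : i = a
      · subst hia
        by_contra hlt
        exact h ⟨hi, j, hj, r, hr, not_le.1 hlt⟩
      · exact hzero i hi (by simp [hia, hiL]) j hj r hr

end Welfare

/-- Under binary additive utilities, the Welfare-Prioritized Serial Dictatorship
mechanism (with a valid selection rule `sel` picking a remaining agent maximizing the
agent's compatibility value and a remaining room maximizing its room value, and a valid
report-independent completion rule `comp`) is strategyproof and achieves at least one
seventh of the maximum social welfare. -/
theorem WPSD_SP_and_one_seventh
    {N R : Type*} [Fintype N] [Fintype R] [DecidableEq N] [DecidableEq R] (n : ℕ)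
    (hN : Fintype.card N = 2 * n) (hR : Fintype.card R = n)
    (L : List N) (hnd : L.Nodup) (hfull : ∀ a : N, a ∈ L)
    (sel : N → (N → ℝ) → (R → ℝ) → Finset N → Finset R → N × R)
    (hsel : ∀ (a : N) (va : N → ℝ) (vha : R → ℝ) (A : Finset N) (B : Finset R),
      (∃ j ∈ A, ∃ r ∈ B, 0 < va j + vha r) →
      (sel a va vha A B).1 ∈ A ∧ (sel a va vha A B).2 ∈ B ∧
        (∀ j ∈ A, va j ≤ va (sel a va vha A B).1) ∧
        (∀ r ∈ B, vha r ≤ vha (sel a va vha A B).2))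
    (comp : Finset N → Finset R → List (N × N × R))
    (hcomp : ∀ (A : Finset N) (B : Finset R), A.card = 2 * B.card →
      (∀ t ∈ comp A B, t.1 ∈ A ∧ t.2.1 ∈ A ∧ t.2.2 ∈ B ∧ t.1 ≠ t.2.1) ∧
      (comp A B).Pairwise TripleDisj ∧
      (∀ a ∈ A, ∃ t ∈ comp A B, a = t.1 ∨ a = t.2.1) ∧
      (∀ r ∈ B, ∃ t ∈ comp A B, r = t.2.2))
    (v : N → N → ℝ) (vh : N → R → ℝ) (hbin : Binary v vh) :
    (∀ (i : N) (vi' : N → ℝ) (vhi' : R → ℝ),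
      (∀ j, vi' j = 0 ∨ vi' j = 1) → (∀ r, vhi' r = 0 ∨ vhi' r = 1) →
      listUtilA v vh i
          (wpsdOutput sel comp (Function.update v i vi') (Function.update vh i vhi') L) ≤
        listUtilA v vh i (wpsdOutput sel comp v vh L)) ∧
    (∀ μ' : RMatching N R,
      (1 / 7 : ℝ) * USWA v vh μ' ≤ ∑ a : N, listUtilA v vh a (wpsdOutput sel comp v vh L)) := by
  have hv0 : ∀ i j, 0 ≤ v i j := fun i j => by rcases hbin.1 i j with h | h <;> simp [h]
  have hvh0 : ∀ i r, 0 ≤ vh i r := fun i r => by rcases hbin.2 i r with h | h <;> simp [h]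
  have hc : (Finset.univ : Finset N).card = 2 * (Finset.univ : Finset R).card := by
    rw [Finset.card_univ, Finset.card_univ, hN, hR]
  refine ⟨fun i vi' vhi' _ _ => ?_, fun μ' => ?_⟩
  · rw [wpsdOutput_eq_wpsdFrom, wpsdOutput_eq_wpsdFrom]
    exact wpsdFrom_strategyproof hsel
      (fun A B h => ⟨(hcomp A B h).1, (hcomp A B h).2.1⟩) hv0 hvh0 i vi' vhi' L hc
  · rw [wpsdOutput_eq_wpsdFrom]
    have h1 := sum_availUtil_le_wpsdFrom (comp := comp) hsel hbin μ' L hc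
      fun i _ hi => absurd (hfull i) hi
    have h2 := sum_first_le_sum_listUtilA hv0 hvh0
      (wpsdFrom sel comp v vh L Finset.univ Finset.univ)
    have h3 : USWA v vh μ' =
        ∑ i, availUtil v vh μ' Finset.univ Finset.univ i := by
      simp [USWA, uAdditive, availUtil]
    linarith
end

section
/- A naive maximal matching cannot achieve better than a 1/4 fraction of the maximum welfare under binary additive utilities: there exists a roommate matching instance with 6 agents and 3 rooms and binary valuations with symmetric compatibility valuations such that, under additive utilities, the maximum social welfare over all roommate matchings equals 8, yet there exist distinct agents i, j and a room r with v̂_i(r) = 1 and v̂_j(r) = 1 (so the triple (i, j, r) is formed from two preference-graph edges and may be selected by the naive procedure, contributing welfare 2) such that every complete roommate matching containing the triple (i, j, r) has social welfare exactly 2. -/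
open scoped BigOperators

/-- Agents `0, 2` and agents `1, 3` are mutually compatible, and no other pair is. -/
noncomputable def tightCompat (i j : Fin 6) : ℝ :=
  if (i = 0 ∧ j = 2) ∨ (i = 2 ∧ j = 0) ∨ (i = 1 ∧ j = 3) ∨ (i = 3 ∧ j = 1) then 1 else 0

/-- Agents `0, 1, 4, 5` like room `0`; moreover `0` likes room `1` and `1` likes room `2`. -/
noncomputable def tightRoom (i : Fin 6) (r : Fin 3) : ℝ :=
  if (r = 0 ∧ (i = 0 ∨ i = 1 ∨ i = 4 ∨ i = 5)) ∨ (i = 0 ∧ r = 1) ∨ (i = 1 ∧ r = 2) then 1 else 0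

/-- The matching `{0, 2}` in room `1`, `{1, 3}` in room `2`, `{4, 5}` in room `0`. -/
def tightMatching : RMatching (Fin 6) (Fin 3) where
  partner := ![2, 3, 0, 1, 5, 4]
  room := ![1, 2, 1, 2, 0, 0]
  partner_ne := by decide
  partner_invol := by decide
  room_partner := by decide
  room_pair := by decide

lemma tightCompat_le_one (i j : Fin 6) : tightCompat i j ≤ 1 := by
  unfold tightCompat; split_ifs <;> norm_num

lemma tightRoom_le_one (i : Fin 6) (r : Fin 3) : tightRoom i r ≤ 1 := by
  unfold tightRoom; split_ifs <;> norm_num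

lemma uswa_tightMatching : USWA tightCompat tightRoom tightMatching = 8 := by
  simp [USWA, uAdditive, Fin.sum_univ_six, tightCompat, tightRoom, tightMatching]
  norm_num

lemma uswa_tight_le (μ : RMatching (Fin 6) (Fin 3)) : USWA tightCompat tightRoom μ ≤ 8 := by
  have hc := fun i => tightCompat_le_one i (μ.partner i)
  have hr := fun i => tightRoom_le_one i (μ.room i)
  have r2 : tightRoom 2 (μ.room 2) = 0 := by simp [tightRoom]
  have r3 : tightRoom 3 (μ.room 3) = 0 := by simp [tightRoom]
  have c4 : tightCompat 4 (μ.partner 4) = 0 := by simp [tightCompat]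
  have c5 : tightCompat 5 (μ.partner 5) = 0 := by simp [tightCompat]
  simp only [USWA, uAdditive, Fin.sum_univ_six]
  linarith [hc 0, hc 1, hc 2, hc 3, hr 0, hr 1, hr 4, hr 5]

lemma uswa_tight_of_naive (μ : RMatching (Fin 6) (Fin 3)) (hp : μ.partner 0 = 1)
    (hr : μ.room 0 = 0) : USWA tightCompat tightRoom μ = 2 := by
  have hp' : μ.partner 1 = 0 := by rw [← hp, μ.partner_invol]
  have hr' : μ.room 1 = 0 := by rw [← hp, μ.room_partner, hr]
  have rest : ∀ i : Fin 6, i ≠ 0 → i ≠ 1 → uAdditive tightCompat tightRoom μ i = 0 := by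
    intro i h0 h1
    have hi0 : μ.partner i ≠ 0 := fun h => h1 (by rw [← μ.partner_invol i, h, hp])
    have hi1 : μ.partner i ≠ 1 := fun h => h0 (by rw [← μ.partner_invol i, h, hp'])
    have hir : μ.room i ≠ 0 := fun h =>
      (μ.room_pair 0 i (hr.trans h.symm)).elim h0 fun h' => h1 (h'.trans hp)
    simp [uAdditive, tightCompat, tightRoom, h0, h1, hi0, hi1, hir]
  have u0 : uAdditive tightCompat tightRoom μ 0 = 1 := by
    simp [uAdditive, tightCompat, tightRoom, hp, hr]
  have u1 : uAdditive tightCompat tightRoom μ 1 = 1 := by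
    simp [uAdditive, tightCompat, tightRoom, hp', hr']
  rw [USWA, Fin.sum_univ_six, u0, u1, rest 2 (by decide) (by decide),
    rest 3 (by decide) (by decide), rest 4 (by decide) (by decide), rest 5 (by decide) (by decide)]
  norm_num

/-- A naive maximal matching cannot beat a 1/4 fraction of the optimum under binary
additive utilities: there is a binary symmetric instance with 6 agents and 3 rooms of
maximum social welfare 8 in which some triple `(i, j, r)` formed from the two
preference-graph edges `vh i r = 1` and `vh j r = 1` is such that every complete roommate
matching containing it has social welfare exactly 2. -/
theorem naive_maximal_one_fourth_tight_additive :
    ∃ (v : Fin 6 → Fin 6 → ℝ) (vh : Fin 6 → Fin 3 → ℝ),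
      Binary v vh ∧ Symm v ∧
      (∃ μ : RMatching (Fin 6) (Fin 3), USWA v vh μ = 8) ∧
      (∀ μ : RMatching (Fin 6) (Fin 3), USWA v vh μ ≤ 8) ∧
      ∃ (i j : Fin 6) (r : Fin 3), i ≠ j ∧ vh i r = 1 ∧ vh j r = 1 ∧
        ∀ μ : RMatching (Fin 6) (Fin 3),
          μ.partner i = j → μ.room i = r → USWA v vh μ = 2 := by
  refine ⟨tightCompat, tightRoom, ⟨fun i j => ?_, fun i r => ?_⟩, fun i j => ?_,
    ⟨tightMatching, uswa_tightMatching⟩, uswa_tight_le, 0, 1, 0, by decide, ?_, ?_,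
    uswa_tight_of_naive⟩
  · unfold tightCompat; split_ifs <;> simp
  · unfold tightRoom; split_ifs <;> simp
  · unfold tightCompat; congr 1; grind
  · simp [tightRoom]
  · simp [tightRoom]
end
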